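/- arXiv:0710.0946 — 3 statements merged into one kernel-verified Lean document; each statement's English description precedes it below -/
import Mathlib

section
/- Let t_1, t_2, t_3, t_4 ≥ 0, and for each l ∈ {1,2,3,4} let r_{l1} ≥ r_{l2} ≥ … ≥ r_{l t_l} ≥ 1 be integers; let C ∈ ℝ^{c×c} be a nonsingular real Jordan canonical matrix: block-diagonal of real Jordan blocks J^ℝ_s(λ_i) for distinct nonzero λ_i ∈ ℂ with Im λ_i ≥ 0, blocks of equal λ_i grouped with non-increasing sizes (even sizes when Im λ_i > 0). List the canonical summands in the order: (I_c, C); the type-1 summands (I_{r_{1j}}, J_{r_{1j}}); the type-2 summands (J_{r_{2j}}, I_{r_{2j}}); the type-3 summands (F_{r_{3j}}, G_{r_{3j}}); the type-4 summands (G_{r_{4j}}, F_{r_{4j}}). Let A ∈ ℝ^{m×n} and B ∈ ℝ^{n×m} be the block-diagonal matrices of the first and second components of these summands respectively. Define blocks and H-form as follows: for an ordered pair of summands (i,j), the (i,j)-block of P ∈ ℝ^{m×n} is its sub-block in the rows of summand i and columns of summand j (analogously for Q ∈ ℝ^{n×m}); a block is in H-form if all entries outside its first column are zero when it has at most as many rows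 as columns, and all entries outside its last row are zero otherwise. Let 𝒫 ⊆ ℝ^{m×n} × ℝ^{n×m} consist of pairs (P,Q) such that: the only possibly nonzero blocks of P are, each in H-form, the (i,j)-blocks with i,j both of type 2; i of type 2, j of type 3 or 4; i of type 3 or 4, j of type 2; i,j both of type 3 with i ≤ j; i of type 3, j of type 4; i,j both of type 4 with i > j; and the only possibly nonzero blocks of Q are, each in H-form, the (i,j)-blocks with i,j both of type 1; i of type 1, j of type 2, 3 or 4; i of type 2, 3 or 4, j of type 1; i,j both of type 3 with i > j; i of type 4, j of type 3; i,j both of type 4 with i ≤ j; together with, inside the (C,C)-block of Q, for each ordered pair of real Jordan blocks of C having the same λ_i, the H-form support of the corresponding sub-block. Then ℝ^{m×n} × ℝ^{n×m} is the internal direct sum of 𝒫 and the subspace {(SA − AR, RB − BS) : S ∈ ℝ^{m×m}, R ∈ ℝ^{n×n}}. -/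
open Matrix

namespace ContragredientReal

/-- Entry `(a, b)` (0-indexed) of the real Jordan block `J^ℝ_r(lam)`: for real `lam`
the usual Jordan block; for `lam = x + y i` with `y ≠ 0` the block-tridiagonal matrix
with `2×2` diagonal blocks `T_{xy} = [[x, y], [−y, x]]` and `I_2` blocks on the block
superdiagonal. -/
noncomputable def realJordanEntry (lam : ℂ) (a b : ℕ) : ℝ :=
  if lam.im = 0 then
    (if a = b then lam.re else if b = a + 1 then 1 else 0)
  else if a / 2 = b / 2 then
    (if a % 2 = b % 2 then lam.re else if a % 2 = 0 then lam.im else -lam.im)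
  else if b / 2 = a / 2 + 1 ∧ a % 2 = b % 2 then 1 else 0

/-- H-form support condition for a `rows × cols` block, at position `(a, b)`
(0-indexed): the first column if `rows ≤ cols`, the last row otherwise. -/
def Hcond (rows cols a b : ℕ) : Prop :=
  if rows ≤ cols then b = 0 else a = rows - 1

variable (t1 t2 t3 t4 : ℕ)
variable (r1 : Fin t1 → ℕ) (r2 : Fin t2 → ℕ) (r3 : Fin t3 → ℕ) (r4 : Fin t4 → ℕ)
variable (s : ℕ) (lamC : Fin s → ℂ) (tC : Fin s → ℕ) (szC : ∀ i : Fin s, Fin (tC i) → ℕ)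

/-- Index set of the Jordan canonical matrix `C`. -/
abbrev CI := Σ i : Fin s, Σ j : Fin (tC i), Fin (szC i j)

/-- Index set of the space `U` (rows of `A`, columns of `B`). -/
abbrev Mi := CI s tC szC ⊕ ((Σ j : Fin t1, Fin (r1 j)) ⊕ ((Σ j : Fin t2, Fin (r2 j)) ⊕
  ((Σ j : Fin t3, Fin (r3 j)) ⊕ (Σ j : Fin t4, Fin (r4 j - 1)))))

/-- Index set of the space `V` (columns of `A`, rows of `B`). -/
abbrev Ni := CI s tC szC ⊕ ((Σ j : Fin t1, Fin (r1 j)) ⊕ ((Σ j : Fin t2, Fin (r2 j)) ⊕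
  ((Σ j : Fin t3, Fin (r3 j - 1)) ⊕ (Σ j : Fin t4, Fin (r4 j)))))

/-- The first matrix `A`: block-diagonal with blocks `I_c`, `I_{r_{1j}}`, `J_{r_{2j}}`,
`F_{r_{3j}}`, `G_{r_{4j}}`. -/
def A : Matrix (Mi t1 t2 t3 t4 r1 r2 r3 r4 s tC szC) (Ni t1 t2 t3 t4 r1 r2 r3 r4 s tC szC) ℝ :=
  Matrix.of fun x y =>
    match x, y with
    | Sum.inl c, Sum.inl c' => if c = c' then 1 else 0
    | Sum.inr (Sum.inl ⟨j, a⟩), Sum.inr (Sum.inl ⟨j', b⟩) =>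
        if j = j' ∧ (a : ℕ) = (b : ℕ) then 1 else 0
    | Sum.inr (Sum.inr (Sum.inl ⟨j, a⟩)), Sum.inr (Sum.inr (Sum.inl ⟨j', b⟩)) =>
        if j = j' ∧ (b : ℕ) = (a : ℕ) + 1 then 1 else 0
    | Sum.inr (Sum.inr (Sum.inr (Sum.inl ⟨j, a⟩))), Sum.inr (Sum.inr (Sum.inr (Sum.inl ⟨j', b⟩))) =>
        if j = j' ∧ (a : ℕ) = (b : ℕ) then 1 else 0
    | Sum.inr (Sum.inr (Sum.inr (Sum.inr ⟨j, a⟩))), Sum.inr (Sum.inr (Sum.inr (Sum.inr ⟨j', b⟩))) =>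
        if j = j' ∧ (b : ℕ) = (a : ℕ) + 1 then 1 else 0
    | _, _ => 0

/-- The second matrix `B`: block-diagonal with blocks `C`, `J_{r_{1j}}`, `I_{r_{2j}}`,
`G_{r_{3j}}`, `F_{r_{4j}}`. -/
noncomputable def B : Matrix (Ni t1 t2 t3 t4 r1 r2 r3 r4 s tC szC) (Mi t1 t2 t3 t4 r1 r2 r3 r4 s tC szC) ℝ :=
  Matrix.of fun x y =>
    match x, y with
    | Sum.inl c, Sum.inl c' =>
        if c.1 = c'.1 ∧ (c.2.1 : ℕ) = (c'.2.1 : ℕ) then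
          realJordanEntry (lamC c.1) c.2.2 c'.2.2 else 0
    | Sum.inr (Sum.inl ⟨j, a⟩), Sum.inr (Sum.inl ⟨j', b⟩) =>
        if j = j' ∧ (b : ℕ) = (a : ℕ) + 1 then 1 else 0
    | Sum.inr (Sum.inr (Sum.inl ⟨j, a⟩)), Sum.inr (Sum.inr (Sum.inl ⟨j', b⟩)) =>
        if j = j' ∧ (a : ℕ) = (b : ℕ) then 1 else 0
    | Sum.inr (Sum.inr (Sum.inr (Sum.inl ⟨j, a⟩))), Sum.inr (Sum.inr (Sum.inr (Sum.inl ⟨j', b⟩))) =>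
        if j = j' ∧ (b : ℕ) = (a : ℕ) + 1 then 1 else 0
    | Sum.inr (Sum.inr (Sum.inr (Sum.inr ⟨j, a⟩))), Sum.inr (Sum.inr (Sum.inr (Sum.inr ⟨j', b⟩))) =>
        if j = j' ∧ (a : ℕ) = (b : ℕ) then 1 else 0
    | _, _ => 0

/-- Support of the first component `P ∈ ℝ^{m×n}` of the miniversal deformation. -/
def PSupp : Mi t1 t2 t3 t4 r1 r2 r3 r4 s tC szC → Ni t1 t2 t3 t4 r1 r2 r3 r4 s tC szC → Prop
  | Sum.inr (Sum.inr (Sum.inl ⟨j, a⟩)), Sum.inr (Sum.inr (Sum.inl ⟨j', b⟩)) =>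
      Hcond (r2 j) (r2 j') a b
  | Sum.inr (Sum.inr (Sum.inl ⟨j, a⟩)), Sum.inr (Sum.inr (Sum.inr (Sum.inl ⟨j', b⟩))) =>
      Hcond (r2 j) (r3 j' - 1) a b
  | Sum.inr (Sum.inr (Sum.inl ⟨j, a⟩)), Sum.inr (Sum.inr (Sum.inr (Sum.inr ⟨j', b⟩))) =>
      Hcond (r2 j) (r4 j') a b
  | Sum.inr (Sum.inr (Sum.inr (Sum.inl ⟨j, a⟩))), Sum.inr (Sum.inr (Sum.inl ⟨j', b⟩)) =>
      Hcond (r3 j) (r2 j') a b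
  | Sum.inr (Sum.inr (Sum.inr (Sum.inr ⟨j, a⟩))), Sum.inr (Sum.inr (Sum.inl ⟨j', b⟩)) =>
      Hcond (r4 j - 1) (r2 j') a b
  | Sum.inr (Sum.inr (Sum.inr (Sum.inl ⟨j, a⟩))), Sum.inr (Sum.inr (Sum.inr (Sum.inl ⟨j', b⟩))) =>
      (j : ℕ) ≤ (j' : ℕ) ∧ Hcond (r3 j) (r3 j' - 1) a b
  | Sum.inr (Sum.inr (Sum.inr (Sum.inl ⟨j, a⟩))), Sum.inr (Sum.inr (Sum.inr (Sum.inr ⟨j', b⟩))) =>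
      Hcond (r3 j) (r4 j') a b
  | Sum.inr (Sum.inr (Sum.inr (Sum.inr ⟨j, a⟩))), Sum.inr (Sum.inr (Sum.inr (Sum.inr ⟨j', b⟩))) =>
      (j' : ℕ) < (j : ℕ) ∧ Hcond (r4 j - 1) (r4 j') a b
  | _, _ => False

/-- Support of the second component `Q ∈ ℝ^{n×m}` of the miniversal deformation. -/
def QSupp : Ni t1 t2 t3 t4 r1 r2 r3 r4 s tC szC → Mi t1 t2 t3 t4 r1 r2 r3 r4 s tC szC → Prop
  | Sum.inl c, Sum.inl c' =>
      c.1 = c'.1 ∧ Hcond (szC c.1 c.2.1) (szC c'.1 c'.2.1) c.2.2 c'.2.2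
  | Sum.inr (Sum.inl ⟨j, a⟩), Sum.inr (Sum.inl ⟨j', b⟩) =>
      Hcond (r1 j) (r1 j') a b
  | Sum.inr (Sum.inl ⟨j, a⟩), Sum.inr (Sum.inr (Sum.inl ⟨j', b⟩)) =>
      Hcond (r1 j) (r2 j') a b
  | Sum.inr (Sum.inl ⟨j, a⟩), Sum.inr (Sum.inr (Sum.inr (Sum.inl ⟨j', b⟩))) =>
      Hcond (r1 j) (r3 j') a b
  | Sum.inr (Sum.inl ⟨j, a⟩), Sum.inr (Sum.inr (Sum.inr (Sum.inr ⟨j', b⟩))) =>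
      Hcond (r1 j) (r4 j' - 1) a b
  | Sum.inr (Sum.inr (Sum.inl ⟨j, a⟩)), Sum.inr (Sum.inl ⟨j', b⟩) =>
      Hcond (r2 j) (r1 j') a b
  | Sum.inr (Sum.inr (Sum.inr (Sum.inl ⟨j, a⟩))), Sum.inr (Sum.inl ⟨j', b⟩) =>
      Hcond (r3 j - 1) (r1 j') a b
  | Sum.inr (Sum.inr (Sum.inr (Sum.inr ⟨j, a⟩))), Sum.inr (Sum.inl ⟨j', b⟩) =>
      Hcond (r4 j) (r1 j') a b
  | Sum.inr (Sum.inr (Sum.inr (Sum.inl ⟨j, a⟩))), Sum.inr (Sum.inr (Sum.inr (Sum.inl ⟨j', b⟩))) =>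
      (j' : ℕ) < (j : ℕ) ∧ Hcond (r3 j - 1) (r3 j') a b
  | Sum.inr (Sum.inr (Sum.inr (Sum.inr ⟨j, a⟩))), Sum.inr (Sum.inr (Sum.inr (Sum.inl ⟨j', b⟩))) =>
      Hcond (r4 j) (r3 j') a b
  | Sum.inr (Sum.inr (Sum.inr (Sum.inr ⟨j, a⟩))), Sum.inr (Sum.inr (Sum.inr (Sum.inr ⟨j', b⟩))) =>
      (j : ℕ) ≤ (j' : ℕ) ∧ Hcond (r4 j) (r4 j' - 1) a b
  | _, _ => False

/-- The coordinate subspace of matrices supported on `supp` is a complement of the range of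
the Sylvester operator `X ↦ X * K - L * X`. -/
def SupportCompl {m n : Type*} [Fintype m] [Fintype n] (L : Matrix m m ℝ) (K : Matrix n n ℝ)
    (supp : m → n → Prop) : Prop :=
  (∀ Y : Matrix m n ℝ, ∃ Z X : Matrix m n ℝ,
    (∀ a b, ¬ supp a b → Z a b = 0) ∧ Y = Z + (X * K - L * X)) ∧
  ∀ Z X : Matrix m n ℝ, (∀ a b, ¬ supp a b → Z a b = 0) → Z + (X * K - L * X) = 0 → Z = 0

theorem SupportCompl.congr {m n : Type*} [Fintype m] [Fintype n] {L : Matrix m m ℝ}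
    {K : Matrix n n ℝ} {supp supp' : m → n → Prop} (h : SupportCompl L K supp)
    (hs : ∀ a b, supp a b ↔ supp' a b) : SupportCompl L K supp' := by
  have : supp = supp' := funext₂ fun a b => propext (hs a b)
  rwa [← this]

theorem SupportCompl.submatrix {m n m' n' : Type*} [Fintype m] [Fintype n] [Fintype m']
    [Fintype n'] {L : Matrix m m ℝ} {K : Matrix n n ℝ} {supp : m → n → Prop}
    (h : SupportCompl L K supp) (e : m' ≃ m) (f : n' ≃ n) :
    SupportCompl (L.submatrix e e) (K.submatrix f f) (fun a b => supp (e a) (f b)) := by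
  refine ⟨fun Y => ?_, fun Z X hZ hE => ?_⟩
  · obtain ⟨Z, X, hZ, hY⟩ := h.1 (Y.submatrix e.symm f.symm)
    refine ⟨Z.submatrix e f, X.submatrix e f, fun a b hab => hZ _ _ hab, ?_⟩
    have := congrArg (fun W => W.submatrix e f) hY
    rw [Matrix.submatrix_mul_equiv, Matrix.submatrix_mul_equiv]
    have hY' : Y = (Z + (X * K - L * X)).submatrix e f := by simpa using this
    exact hY'
  · have h0 : Z.submatrix e.symm f.symm = 0 := by
      refine h.2 _ (X.submatrix e.symm f.symm) (fun a b hab => hZ _ _ (by simpa using hab)) ?_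
      have := congrArg (fun W => W.submatrix e.symm f.symm) hE
      rw [Matrix.submatrix_add, Matrix.submatrix_sub, Pi.add_apply, Pi.add_apply,
        Pi.sub_apply, Pi.sub_apply, ← Matrix.submatrix_mul_equiv (e₂ := f.symm),
        ← Matrix.submatrix_mul_equiv (e₂ := e.symm)] at this
      simpa using this
    ext a b
    simpa using congrFun (congrFun h0 (e a)) (f b)

theorem mul_blockDiagonal'_apply {ι m : Type*} {n : ι → Type*} [Fintype ι] [DecidableEq ι]
    [∀ i, Fintype (n i)] (J : ∀ i, Matrix (n i) (n i) ℝ) (X : Matrix m (Σ i, n i) ℝ) (a : m)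
    (i : ι) (b : n i) :
    (X * blockDiagonal' J) a ⟨i, b⟩ = ∑ c, X a ⟨i, c⟩ * J i c b := by
  rw [mul_apply, Fintype.sum_sigma, Finset.sum_eq_single i]
  · simp
  · intro j _ hj
    simp [blockDiagonal'_apply_ne _ _ _ hj]
  · simp

theorem blockDiagonal'_mul_apply {ι m : Type*} {n : ι → Type*} [Fintype ι] [DecidableEq ι]
    [∀ i, Fintype (n i)] (J : ∀ i, Matrix (n i) (n i) ℝ) (X : Matrix (Σ i, n i) m ℝ) (a : m)
    (i : ι) (b : n i) :
    (blockDiagonal' J * X) ⟨i, b⟩ a = ∑ c, J i b c * X ⟨i, c⟩ a := by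
  rw [mul_apply, Fintype.sum_sigma, Finset.sum_eq_single i]
  · simp
  · intro j _ hj
    simp [blockDiagonal'_apply_ne _ _ _ hj.symm]
  · simp

theorem SupportCompl.blockDiagonal' {ι : Type*} {n : ι → Type*} [Fintype ι] [DecidableEq ι]
    [∀ i, Fintype (n i)] (J : ∀ i, Matrix (n i) (n i) ℝ) (supp : (Σ i, n i) → (Σ i, n i) → Prop)
    (h : ∀ i j, SupportCompl (J i) (J j) (fun a b => supp ⟨i, a⟩ ⟨j, b⟩)) :
    SupportCompl (Matrix.blockDiagonal' J) (Matrix.blockDiagonal' J) supp := by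
  refine ⟨fun Y => ?_, fun Z X hZ hE => ?_⟩
  · choose Z X hZ hY using fun i j => (h i j).1 (of fun a b => Y ⟨i, a⟩ ⟨j, b⟩)
    refine ⟨of fun x y => Z x.1 y.1 x.2 y.2, of fun x y => X x.1 y.1 x.2 y.2,
      fun a b hab => hZ _ _ _ _ hab, ?_⟩
    ext ⟨i, a⟩ ⟨j, b⟩
    have := congrFun (congrFun (hY i j) a) b
    rw [Matrix.add_apply, Matrix.sub_apply, mul_blockDiagonal'_apply, blockDiagonal'_mul_apply]
    simpa [mul_apply] using this
  · ext ⟨i, a⟩ ⟨j, b⟩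
    refine congrFun (congrFun ((h i j).2 (of fun a b => Z ⟨i, a⟩ ⟨j, b⟩)
      (of fun a b => X ⟨i, a⟩ ⟨j, b⟩) (fun a b hab => hZ _ _ hab) ?_) a) b
    ext a b
    have := congrFun (congrFun hE ⟨i, a⟩) ⟨j, b⟩
    rw [Matrix.add_apply, Matrix.sub_apply, mul_blockDiagonal'_apply,
      blockDiagonal'_mul_apply] at this
    simpa [mul_apply] using this

theorem supportCompl_of_injective {m n : Type*} [Fintype m] [Fintype n] {L : Matrix m m ℝ}
    {K : Matrix n n ℝ} (h : ∀ X : Matrix m n ℝ, X * K = L * X → X = 0) :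
    SupportCompl L K (fun _ _ => False) := by
  let f : Matrix m n ℝ →ₗ[ℝ] Matrix m n ℝ :=
    { toFun := fun X => X * K - L * X
      map_add' := fun X Y => by simp only [Matrix.add_mul, Matrix.mul_add]; abel
      map_smul' := fun r X => by simp [smul_sub] }
  have hf : Function.Injective f := by
    rw [injective_iff_map_eq_zero]
    exact fun X hX => h X (sub_eq_zero.mp hX)
  refine ⟨fun Y => ?_, fun Z X hZ _ => by ext a b; exact hZ a b id⟩
  obtain ⟨X, hX⟩ := LinearMap.surjective_of_injective hf Y
  exact ⟨0, X, fun _ _ _ => rfl, by rw [zero_add]; exact hX.symm⟩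

theorem mul_pow_eq_pow_mul {m n : Type*} [Fintype m] [Fintype n] [DecidableEq m] [DecidableEq n]
    {L : Matrix m m ℝ} {K : Matrix n n ℝ} {X : Matrix m n ℝ} (h : X * K = L * X) (k : ℕ) :
    X * K ^ k = L ^ k * X := by
  induction k with
  | zero => simp
  | succ k ih => rw [pow_succ, ← Matrix.mul_assoc, ih, Matrix.mul_assoc, h, ← Matrix.mul_assoc,
      ← pow_succ]

theorem mul_aeval_eq_aeval_mul {m n : Type*} [Fintype m] [Fintype n] [DecidableEq m]
    [DecidableEq n] {L : Matrix m m ℝ} {K : Matrix n n ℝ} {X : Matrix m n ℝ}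
    (h : X * K = L * X) (p : Polynomial ℝ) :
    X * Polynomial.aeval K p = Polynomial.aeval L p * X := by
  induction p using Polynomial.induction_on' with
  | add p q hp hq => simp [Matrix.mul_add, Matrix.add_mul, hp, hq]
  | monomial k a =>
    simp only [Polynomial.aeval_monomial, Algebra.algebraMap_eq_smul_one, smul_mul_assoc, one_mul,
      Matrix.mul_smul, Matrix.smul_mul, mul_pow_eq_pow_mul h]

theorem eq_zero_of_mul_eq_mul_of_isUnit_left {m n : Type*} [Fintype m] [Fintype n] [DecidableEq m]
    [DecidableEq n] {L : Matrix m m ℝ} {K : Matrix n n ℝ} (hL : IsUnit L) (hK : IsNilpotent K)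
    {X : Matrix m n ℝ} (h : X * K = L * X) : X = 0 := by
  obtain ⟨k, hk⟩ := hK
  obtain ⟨U, hU⟩ := (hL.pow k).exists_left_inv
  have := mul_pow_eq_pow_mul h k
  rw [hk, Matrix.mul_zero] at this
  rw [← Matrix.one_mul X, ← hU, Matrix.mul_assoc, ← this, Matrix.mul_zero]

theorem eq_zero_of_mul_eq_mul_of_isUnit_right {m n : Type*} [Fintype m] [Fintype n]
    [DecidableEq m] [DecidableEq n] {L : Matrix m m ℝ} {K : Matrix n n ℝ} (hL : IsNilpotent L)
    (hK : IsUnit K) {X : Matrix m n ℝ} (h : X * K = L * X) : X = 0 := by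
  obtain ⟨k, hk⟩ := hL
  obtain ⟨U, hU⟩ := (hK.pow k).exists_right_inv
  have := mul_pow_eq_pow_mul h k
  rw [hk, Matrix.zero_mul] at this
  rw [← Matrix.mul_one X, ← hU, ← Matrix.mul_assoc, this, Matrix.zero_mul]

theorem isUnit_aeval_of_isCoprime {m : Type*} [Fintype m] [DecidableEq m] {K : Matrix m m ℝ}
    {p q : Polynomial ℝ} (hpq : IsCoprime p q) (hq : IsNilpotent (Polynomial.aeval K q)) :
    IsUnit (Polynomial.aeval K p) := by
  obtain ⟨u, v, huv⟩ := hpq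
  have h1 : Polynomial.aeval K u * Polynomial.aeval K p =
      1 - Polynomial.aeval K v * Polynomial.aeval K q := by
    rw [eq_sub_iff_add_eq, ← map_mul, ← map_mul, ← map_add, huv, map_one]
  have hc : Commute (Polynomial.aeval K v) (Polynomial.aeval K q) := by
    rw [commute_iff_eq, ← map_mul, ← map_mul, mul_comm]
  have h2 := (hc.isNilpotent_mul_left hq).isUnit_one_sub
  rw [← h1] at h2
  have hc' : Commute (Polynomial.aeval K u) (Polynomial.aeval K p) := by
    rw [commute_iff_eq, ← map_mul, ← map_mul, mul_comm]
  exact (hc'.isUnit_mul_iff.mp h2).2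

theorem supportCompl_of_isCoprime {m n : Type*} [Fintype m] [Fintype n] [DecidableEq m]
    [DecidableEq n] {L : Matrix m m ℝ} {K : Matrix n n ℝ} {p q : Polynomial ℝ}
    (hpq : IsCoprime p q) (hL : IsNilpotent (Polynomial.aeval L p))
    (hK : IsNilpotent (Polynomial.aeval K q)) : SupportCompl L K (fun _ _ => False) :=
  supportCompl_of_injective fun _ hX => eq_zero_of_mul_eq_mul_of_isUnit_right hL
    (isUnit_aeval_of_isCoprime hpq hK) (mul_aeval_eq_aeval_mul hX p)

theorem isNilpotent_of_weight {m : Type*} [Fintype m] [DecidableEq m] {T : Matrix m m ℝ}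
    (w : m → ℕ) (h : ∀ a b, T a b ≠ 0 → w a < w b) : IsNilpotent T := by
  have key : ∀ (k : ℕ) (a b : m), (T ^ k) a b ≠ 0 → w a + k ≤ w b := by
    intro k
    induction k with
    | zero =>
      intro a b hab
      rw [pow_zero] at hab
      by_cases hne : a = b
      · simp [hne]
      · exact absurd (one_apply_ne hne) hab
    | succ k ih =>
      intro a b hab
      rw [pow_succ, mul_apply] at hab
      obtain ⟨c, _, hc⟩ := Finset.exists_ne_zero_of_sum_ne_zero hab
      have h1 := ih a c (left_ne_zero_of_mul hc)
      have h2 := h c b (right_ne_zero_of_mul hc)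
      omega
  refine ⟨(∑ a, w a) + 1, ?_⟩
  ext a b
  by_contra hab
  have h1 := key _ a b hab
  have h2 := Finset.single_le_sum (f := w) (fun _ _ => Nat.zero_le _) (Finset.mem_univ b)
  omega

/-- The nilpotent Jordan block of size `p`. -/
def nilJordan (p : ℕ) : Matrix (Fin p) (Fin p) ℝ :=
  of fun a b => if (b : ℕ) = (a : ℕ) + 1 then 1 else 0

theorem isNilpotent_nilJordan (p : ℕ) : IsNilpotent (nilJordan p) := by
  refine isNilpotent_of_weight (fun a => (a : ℕ)) fun a b h => ?_
  by_contra h'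
  apply h
  simp only [nilJordan, of_apply, ite_eq_right_iff, one_ne_zero]
  omega

/-- Extension by zero of a matrix to all pairs of natural numbers. -/
def extendZero {p q : ℕ} (Y : Matrix (Fin p) (Fin q) ℝ) (a b : ℕ) : ℝ :=
  if h : a < p ∧ b < q then Y ⟨a, h.1⟩ ⟨b, h.2⟩ else 0

@[simp] theorem extendZero_val {p q : ℕ} (Y : Matrix (Fin p) (Fin q) ℝ) (a : Fin p)
    (b : Fin q) : extendZero Y a b = Y a b := by
  simp [extendZero]

theorem extendZero_of_not {p q : ℕ} (Y : Matrix (Fin p) (Fin q) ℝ) {a b : ℕ}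
    (h : ¬ (a < p ∧ b < q)) : extendZero Y a b = 0 := by
  simp [extendZero, h]

theorem mul_nilJordan_apply {p q : ℕ} (X : Matrix (Fin p) (Fin q) ℝ) (a : Fin p) (b : Fin q) :
    (X * nilJordan q) a b = if (b : ℕ) = 0 then 0 else extendZero X a (b - 1) := by
  rw [mul_apply]
  split_ifs with h
  · refine Finset.sum_eq_zero fun c _ => ?_
    simp [nilJordan, h]
  · have hb : (b : ℕ) - 1 < q := by omega
    rw [Finset.sum_eq_single ⟨b - 1, hb⟩]
    · have : (b : ℕ) = b - 1 + 1 := by omega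
      simp [nilJordan, extendZero, hb, ← this]
    · intro c _ hc
      have : ¬ (b : ℕ) = c + 1 := fun h' => hc (Fin.ext (by simp; omega))
      simp [nilJordan, this]
    · simp

theorem nilJordan_mul_apply {p q : ℕ} (X : Matrix (Fin p) (Fin q) ℝ) (a : Fin p) (b : Fin q) :
    (nilJordan p * X) a b = extendZero X (a + 1) b := by
  rw [mul_apply]
  by_cases h : (a : ℕ) + 1 < p
  · rw [Finset.sum_eq_single ⟨a + 1, h⟩]
    · simp [nilJordan, extendZero, h]
    · intro c _ hc
      have : ¬ (c : ℕ) = a + 1 := fun h' => hc (Fin.ext (by simp; omega))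
      simp [nilJordan, this]
    · simp
  · rw [extendZero_of_not _ (by omega)]
    refine Finset.sum_eq_zero fun c _ => ?_
    have : ¬ (c : ℕ) = a + 1 := by omega
    simp [nilJordan, this]

/-- A support meeting every lower diagonal `a - b = e` with `e ≥ max 0 (p - q)` exactly once,
and no other diagonal, is complementary to the Sylvester operator of two nilpotent Jordan
blocks. -/
theorem supportCompl_nilJordan {p q : ℕ} (supp : Fin p → Fin q → Prop)
    (h1 : ∀ a b, supp a b → (b : ℕ) ≤ a ∧ p + b ≤ q + a)
    (h2 : ∀ a b a' b', supp a b → supp a' b' → (a : ℕ) + b' = a' + b → a = a' ∧ b = b')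
    (h3 : ∀ e < p, p ≤ q + e → ∃ a b, supp a b ∧ (a : ℕ) = b + e) :
    SupportCompl (nilJordan p) (nilJordan q) supp := by
  classical
  have diag : ∀ (Z : Matrix (Fin p) (Fin q) ℝ), (∀ a b, ¬ supp a b → Z a b = 0) →
      ∀ a b, supp a b → ∀ n : ℕ, (b : ℕ) < n →
        ∑ i ∈ Finset.range n, extendZero Z (a - b + i) i = Z a b := by
    intro Z hZ a b hab n hn
    have hba := (h1 a b hab).1
    rw [Finset.sum_eq_single (b : ℕ)]
    · rw [Nat.sub_add_cancel hba, extendZero_val]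
    · intro i _ hi
      by_cases hr : (a : ℕ) - b + i < p ∧ i < q
      · have : extendZero Z (a - b + i) i = Z ⟨a - b + i, hr.1⟩ ⟨i, hr.2⟩ := by
          simp [extendZero, hr]
        rw [this]
        refine hZ _ _ fun hs => hi ?_
        have := (h2 _ _ _ _ hs hab (by simp; omega)).2
        simpa using congrArg Fin.val this
      · exact extendZero_of_not _ hr
    · intro h
      exact absurd (Finset.mem_range.mpr hn) h
  refine ⟨fun Y => ?_, fun Z X hZ hE => ?_⟩
  · let Z : Matrix (Fin p) (Fin q) ℝ := of fun a b =>
      if supp a b then ∑ i ∈ Finset.range q, extendZero Y (a - b + i) i else 0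
    let X : Matrix (Fin p) (Fin q) ℝ := of fun a b =>
      if (a : ℕ) ≤ b then ∑ k ∈ Finset.range q, extendZero Y (a + k) (b + 1 + k)
      else -∑ i ∈ Finset.range (b + 1), extendZero (Y - Z) (a - 1 - b + i) i
    have hZ : ∀ a b, ¬ supp a b → Z a b = 0 := fun a b h => by simp [Z, h]
    refine ⟨Z, X, hZ, ?_⟩
    have eE : ∀ a b, extendZero (Y - Z) a b = extendZero Y a b - extendZero Z a b := by
      intro a b
      unfold extendZero
      split_ifs <;> simp
    have eX : ∀ a b : ℕ, b < q → extendZero X a b =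
        if a ≤ b then ∑ k ∈ Finset.range q, extendZero Y (a + k) (b + 1 + k)
        else if a < p then -∑ i ∈ Finset.range (b + 1), extendZero (Y - Z) (a - 1 - b + i) i
        else 0 := by
      intro a b hb
      by_cases ha : a < p
      · simp [extendZero, ha, hb, X]
      · rw [extendZero_of_not _ (by omega)]
        split_ifs
        · refine (Finset.sum_eq_zero fun k _ => extendZero_of_not _ (by omega)).symm
        · rfl
    ext a b
    rw [Matrix.add_apply, Matrix.sub_apply, mul_nilJordan_apply, nilJordan_mul_apply,
      eX _ _ b.2, eX _ (b - 1) (by omega)]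
    by_cases hab : (a : ℕ) < b
    · rw [hZ a b fun h => by have := (h1 a b h).1; omega, if_neg (by omega), if_pos (by omega),
        if_pos (by omega), zero_add]
      have e1 := Finset.sum_range_succ' (fun k => extendZero Y (a + k) (b + k)) q
      rw [Finset.sum_range_succ, extendZero_of_not Y (a := a + q) (by omega)] at e1
      simp only [add_zero, extendZero_val] at e1
      have e2 : ∀ k : ℕ, (b : ℕ) - 1 + 1 + k = b + k := by omega
      have e3 : ∀ k : ℕ, (a : ℕ) + 1 + k = a + (k + 1) := by omega
      have e4 : ∀ k : ℕ, (b : ℕ) + 1 + k = b + (k + 1) := by omega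
      simp only [e2, e3, e4]
      rw [e1]
      ring
    · have step : (if (b : ℕ) = 0 then (0 : ℝ) else -∑ i ∈ Finset.range b,
          extendZero (Y - Z) (a - b + i) i) + ∑ i ∈ Finset.range (b + 1),
          extendZero (Y - Z) (a - b + i) i = Y a b - Z a b := by
        rw [Finset.sum_range_succ, Nat.sub_add_cancel (by omega), extendZero_val,
          Matrix.sub_apply]
        split_ifs with hb
        · simp [hb]
        · ring
      rw [if_neg (show ¬ (a : ℕ) + 1 ≤ b by omega)]
      have eA : (if (b : ℕ) = 0 then (0 : ℝ) else
          if (a : ℕ) ≤ b - 1 then ∑ k ∈ Finset.range q, extendZero Y (a + k) (b - 1 + 1 + k)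
          else if (a : ℕ) < p then -∑ i ∈ Finset.range (b - 1 + 1),
            extendZero (Y - Z) (a - 1 - (b - 1) + i) i else 0) =
          (if (b : ℕ) = 0 then (0 : ℝ) else -∑ i ∈ Finset.range b,
          extendZero (Y - Z) (a - b + i) i) := by
        split_ifs with hb h' h''
        · rfl
        · omega
        · have e1 : (b : ℕ) - 1 + 1 = b := by omega
          have e2 : (a : ℕ) - 1 - (b - 1) = a - b := by omega
          rw [e1, e2]
        · omega
      rw [eA]
      have e5 : (a : ℕ) + 1 - 1 - b = a - b := by omega
      rw [e5]
      by_cases hp : (a : ℕ) + 1 < p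
      · rw [if_pos hp, sub_neg_eq_add, step]
        ring
      · have hs : ∑ i ∈ Finset.range (b + 1), extendZero (Y - Z) (a - b + i) i = 0 := by
          obtain ⟨a0, b0, h0, he⟩ := h3 (a - b) (by omega) (by omega)
          have e6 : (a : ℕ) - b = a0 - b0 := by omega
          simp only [eE, Finset.sum_sub_distrib]
          rw [e6, diag Z hZ a0 b0 h0 _ (by omega), sub_eq_zero]
          have : Z a0 b0 = ∑ i ∈ Finset.range q, extendZero Y (a0 - b0 + i) i := by
            simp [Z, h0]
          rw [this]
          refine Finset.sum_subset (fun i hi => ?_) fun i _ hi => extendZero_of_not _ ?_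
          · simp only [Finset.mem_range] at hi ⊢
            omega
          · simp only [Finset.mem_range] at hi
            omega
        rw [if_neg hp, sub_zero]
        rw [hs, add_zero] at step
        rw [step]
        ring
  · ext a b
    by_cases hab : supp a b
    · obtain ⟨hba, hpq⟩ := h1 a b hab
      let f : ℕ → ℝ := fun i => if i = 0 then 0 else extendZero X (a - b + i) (i - 1)
      have hf : ∀ i ∈ Finset.range (p - (a - b)),
          extendZero Z (a - b + i) i = f (i + 1) - f i := by
        intro i hi
        rw [Finset.mem_range] at hi
        have hi1 : (a : ℕ) - b + i < p := by omega
        have hi2 : i < q := by omega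
        have := congrFun (congrFun hE ⟨a - b + i, hi1⟩) ⟨i, hi2⟩
        rw [Matrix.add_apply, Matrix.sub_apply, mul_nilJordan_apply, nilJordan_mul_apply,
          ← extendZero_val Z, Matrix.zero_apply] at this
        simp only at this
        simp only [f, Nat.add_sub_cancel, Nat.succ_ne_zero, if_false, ← add_assoc]
        linarith
      rw [← diag Z hZ a b hab (p - (a - b)) (by omega), Finset.sum_congr rfl hf,
        Finset.sum_range_sub]
      simp only [f, if_true, sub_zero, Matrix.zero_apply]
      split_ifs
      · rfl
      · exact extendZero_of_not _ (by omega)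
    · exact hZ a b hab

theorem supportCompl_nilJordan_hcond (p q : ℕ) :
    SupportCompl (nilJordan p) (nilJordan q) (fun a b => Hcond p q a b) := by
  refine supportCompl_nilJordan _ (fun a b h => ?_) (fun a b a' b' h h' he => ?_)
    fun e he hpq => ?_
  · unfold Hcond at h
    split_ifs at h <;> omega
  · unfold Hcond at h h'
    rw [Fin.ext_iff, Fin.ext_iff]
    split_ifs at h h' <;> omega
  · by_cases h : p ≤ q
    · exact ⟨⟨e, he⟩, ⟨0, by omega⟩, by simp [Hcond, h], by simp⟩
    · exact ⟨⟨p - 1, by omega⟩, ⟨p - 1 - e, by omega⟩, by simp [Hcond, h], by simp; omega⟩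

theorem SupportCompl.add_smul_one {m n : Type*} [Fintype m] [Fintype n] [DecidableEq m]
    [DecidableEq n] {L : Matrix m m ℝ} {K : Matrix n n ℝ} {supp : m → n → Prop}
    (h : SupportCompl L K supp) (c : ℝ) : SupportCompl (L + c • 1) (K + c • 1) supp := by
  have e : ∀ X : Matrix m n ℝ, X * (K + c • 1) - (L + c • 1) * X = X * K - L * X := by
    intro X
    simp only [Matrix.mul_add, Matrix.add_mul, Matrix.mul_smul, Matrix.smul_mul, Matrix.mul_one,
      Matrix.one_mul]
    abel
  unfold SupportCompl
  simp only [e]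
  exact h

/-- The real Jordan block `J^ℝ_p(lam)`. -/
noncomputable def realJordan (lam : ℂ) (p : ℕ) : Matrix (Fin p) (Fin p) ℝ :=
  of fun a b => realJordanEntry lam a b

theorem realJordan_of_im_eq_zero {lam : ℂ} (h : lam.im = 0) (p : ℕ) :
    realJordan lam p = nilJordan p + lam.re • 1 := by
  ext a b
  simp only [realJordan, realJordanEntry, h, if_true, of_apply, nilJordan, Matrix.add_apply,
    Matrix.smul_apply, Matrix.one_apply, Fin.ext_iff, smul_eq_mul, mul_ite, mul_one, mul_zero]
  split_ifs <;> first | omega | simp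

/-- The real Jordan block of even size, with the even-indexed coordinates listed before the
odd-indexed ones. -/
noncomputable def jordanBlocks (x y : ℝ) (r : ℕ) : Matrix (Fin r ⊕ Fin r) (Fin r ⊕ Fin r) ℝ :=
  fromBlocks (nilJordan r + x • 1) (y • 1) (-y • 1) (nilJordan r + x • 1)

/-- Splitting of `Fin (r + r)` into even and odd elements. -/
def parityEquiv (r : ℕ) : Fin (r + r) ≃ Fin r ⊕ Fin r where
  toFun a := if (a : ℕ) % 2 = 0 then Sum.inl ⟨a / 2, by omega⟩ else Sum.inr ⟨a / 2, by omega⟩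
  invFun := Sum.elim (fun a => ⟨2 * a, by omega⟩) (fun a => ⟨2 * a + 1, by omega⟩)
  left_inv a := by
    dsimp only
    split_ifs <;> simp [Fin.ext_iff] <;> omega
  right_inv a := by
    rcases a with a | a
    · simp
    · have h1 : ¬ (2 * (a : ℕ) + 1) % 2 = 0 := by omega
      have h2 : (2 * (a : ℕ) + 1) / 2 = a := by omega
      simp [h2, Nat.add_mod]

theorem realJordan_of_im_ne_zero {lam : ℂ} (h : lam.im ≠ 0) (r : ℕ) :
    realJordan lam (r + r) =
      (jordanBlocks lam.re lam.im r).submatrix (parityEquiv r) (parityEquiv r) := by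
  ext a b
  simp only [realJordan, realJordanEntry, h, if_false, of_apply, submatrix_apply, parityEquiv,
    Equiv.coe_fn_mk, jordanBlocks]
  by_cases ha : (a : ℕ) % 2 = 0 <;> by_cases hb : (b : ℕ) % 2 = 0
  · simp only [ha, hb, if_true, fromBlocks_apply₁₁, Matrix.add_apply, nilJordan, of_apply,
      Matrix.smul_apply, Matrix.one_apply, Fin.ext_iff, and_true, smul_eq_mul, mul_ite, mul_one,
      mul_zero]
    split_ifs <;> first | omega | simp
  · have hb' : (b : ℕ) % 2 = 1 := by omega
    simp [ha, hb', Matrix.one_apply]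
  · have ha' : (a : ℕ) % 2 = 1 := by omega
    simp only [ha', hb, one_ne_zero, if_false, if_true, fromBlocks_apply₂₁, Matrix.smul_apply,
      Matrix.one_apply, Fin.ext_iff, and_false, smul_eq_mul, mul_ite, mul_one, mul_zero]
  · have ha' : (a : ℕ) % 2 = 1 := by omega
    have hb' : (b : ℕ) % 2 = 1 := by omega
    simp only [ha', hb', one_ne_zero, if_false, if_true, fromBlocks_apply₂₂, Matrix.add_apply,
      nilJordan, of_apply, Matrix.smul_apply, Matrix.one_apply, Fin.ext_iff, and_true,
      smul_eq_mul, mul_ite, mul_one, mul_zero]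
    split_ifs <;> first | omega | simp

/-- The polynomial `(X - lam) (X - conj lam)`. -/
noncomputable def conjPoly (lam : ℂ) : Polynomial ℝ :=
  Polynomial.X ^ 2 - Polynomial.C (2 * lam.re) * Polynomial.X +
    Polynomial.C (lam.re ^ 2 + lam.im ^ 2)

theorem aeval_conjPoly {m : Type*} [Fintype m] [DecidableEq m] (lam : ℂ) (T : Matrix m m ℝ) :
    Polynomial.aeval T (conjPoly lam) =
      T * T - (2 * lam.re) • T + (lam.re ^ 2 + lam.im ^ 2) • (1 : Matrix m m ℝ) := by
  simp only [conjPoly, map_add, map_sub, map_mul, Polynomial.aeval_X,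
    Polynomial.aeval_C, pow_two, Algebra.algebraMap_eq_smul_one, smul_mul_assoc, one_mul]
  module

theorem map_conjPoly (lam : ℂ) : (conjPoly lam).map (algebraMap ℝ ℂ) =
    (Polynomial.X - Polynomial.C lam) *
      (Polynomial.X - Polynomial.C ((starRingEnd ℂ) lam)) := by
  have h1 : ((2 * lam.re : ℝ) : ℂ) = lam + (starRingEnd ℂ) lam := by
    rw [Complex.add_conj]
  have h2 : ((lam.re ^ 2 + lam.im ^ 2 : ℝ) : ℂ) = lam * (starRingEnd ℂ) lam := by
    rw [Complex.mul_conj, Complex.normSq_apply]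
    push_cast
    ring
  simp only [conjPoly, Polynomial.map_add, Polynomial.map_sub, Polynomial.map_mul,
    Polynomial.map_pow, Polynomial.map_X, Polynomial.map_C, Complex.coe_algebraMap, h1, h2]
  rw [Polynomial.C_add, Polynomial.C_mul]
  ring

theorem isCoprime_conjPoly {lam mu : ℂ} (h1 : lam ≠ mu) (h2 : lam ≠ (starRingEnd ℂ) mu) :
    IsCoprime (conjPoly lam) (conjPoly mu) := by
  rw [← Polynomial.isCoprime_map (algebraMap ℝ ℂ), map_conjPoly, map_conjPoly]
  have key : ∀ {x y : ℂ}, x ≠ y →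
      IsCoprime (Polynomial.X - Polynomial.C x) (Polynomial.X - Polynomial.C y) := fun hxy =>
    Polynomial.isCoprime_X_sub_C_of_isUnit_sub (sub_ne_zero.mpr hxy).isUnit
  have h3 : (starRingEnd ℂ) lam ≠ mu := fun h => h2 (by rw [← h, Complex.conj_conj])
  have h4 : (starRingEnd ℂ) lam ≠ (starRingEnd ℂ) mu := fun h => h1 ((starRingEnd ℂ).injective h)
  exact IsCoprime.mul_left (IsCoprime.mul_right (key h1) (key h2))
    (IsCoprime.mul_right (key h3) (key h4))

theorem isCoprime_X_conjPoly {lam : ℂ} (h : lam ≠ 0) :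
    IsCoprime Polynomial.X (conjPoly lam) := by
  rw [← Polynomial.isCoprime_map (algebraMap ℝ ℂ), map_conjPoly, Polynomial.map_X]
  have key : ∀ {y : ℂ}, y ≠ 0 → IsCoprime Polynomial.X (Polynomial.X - Polynomial.C y) := by
    intro y hy
    have := Polynomial.isCoprime_X_sub_C_of_isUnit_sub (R := ℂ) (a := 0) (b := y)
      (sub_ne_zero.mpr hy.symm).isUnit
    simpa using this
  exact IsCoprime.mul_right (key h) (key (by simpa using h))

theorem fromBlocks_sub {m n m' n' : Type*} (A₁₁ B₁₁ : Matrix m n ℝ) (A₁₂ B₁₂ : Matrix m n' ℝ)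
    (A₂₁ B₂₁ : Matrix m' n ℝ) (A₂₂ B₂₂ : Matrix m' n' ℝ) :
    fromBlocks A₁₁ A₁₂ A₂₁ A₂₂ - fromBlocks B₁₁ B₁₂ B₂₁ B₂₂ =
      fromBlocks (A₁₁ - B₁₁) (A₁₂ - B₁₂) (A₂₁ - B₂₁) (A₂₂ - B₂₂) := by
  ext (i | i) (j | j) <;> rfl

theorem isNilpotent_aeval_jordanBlocks (lam : ℂ) (r : ℕ) :
    IsNilpotent (Polynomial.aeval (jordanBlocks lam.re lam.im r) (conjPoly lam)) := by
  have hN : IsNilpotent (fromBlocks (nilJordan r) 0 0 (nilJordan r)) := by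
    obtain ⟨k, hk⟩ := isNilpotent_nilJordan r
    exact ⟨k, by rw [fromBlocks_diagonal_pow, hk, fromBlocks_zero]⟩
  have e : Polynomial.aeval (jordanBlocks lam.re lam.im r) (conjPoly lam) =
      fromBlocks (nilJordan r) 0 0 (nilJordan r) *
        fromBlocks (nilJordan r) ((2 * lam.im) • 1) (-(2 * lam.im) • 1) (nilJordan r) := by
    rw [aeval_conjPoly, jordanBlocks, fromBlocks_multiply, fromBlocks_multiply, fromBlocks_smul,
      ← fromBlocks_one, fromBlocks_smul, fromBlocks_sub, fromBlocks_add]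
    congr 1 <;>
    · simp only [Matrix.mul_add, Matrix.add_mul, Matrix.mul_smul, Matrix.smul_mul,
        Matrix.mul_one, Matrix.one_mul, Matrix.zero_mul]
      module
  rw [e]
  refine Commute.isNilpotent_mul_right ?_ hN
  rw [commute_iff_eq, fromBlocks_multiply, fromBlocks_multiply]
  simp

theorem isNilpotent_aeval_realJordan {lam : ℂ} {p : ℕ} (h : lam.im ≠ 0 → Even p) :
    IsNilpotent (Polynomial.aeval (realJordan lam p) (conjPoly lam)) := by
  by_cases hl : lam.im = 0
  · have e : Polynomial.aeval (realJordan lam p) (conjPoly lam) =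
        nilJordan p * nilJordan p := by
      rw [aeval_conjPoly, realJordan_of_im_eq_zero hl, hl]
      simp only [Matrix.mul_add, Matrix.add_mul, Matrix.mul_smul, Matrix.smul_mul,
        Matrix.mul_one, Matrix.one_mul]
      module
    rw [e]
    exact (Commute.refl _).isNilpotent_mul_right (isNilpotent_nilJordan p)
  · obtain ⟨r, rfl⟩ := h hl
    rw [realJordan_of_im_ne_zero hl]
    have := (isNilpotent_aeval_jordanBlocks lam r).map
      (Matrix.reindexAlgEquiv ℝ ℝ (parityEquiv r).symm)
    rw [← Polynomial.aeval_algHom_apply] at this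
    exact this

theorem isUnit_realJordan {lam : ℂ} {p : ℕ} (h0 : lam ≠ 0) (h : lam.im ≠ 0 → Even p) :
    IsUnit (realJordan lam p) := by
  simpa using isUnit_aeval_of_isCoprime (isCoprime_X_conjPoly h0) (isNilpotent_aeval_realJordan h)

theorem supportCompl_jordanBlocks (x : ℝ) {y : ℝ} (hy : y ≠ 0) (p q : ℕ) :
    SupportCompl (jordanBlocks x y p) (jordanBlocks x y q) (fun a b =>
      Hcond (p + p) (q + q) ((parityEquiv p).symm a) ((parityEquiv q).symm b)) := by
  set supp : Fin p ⊕ Fin p → Fin q ⊕ Fin q → Prop := fun a b =>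
      Hcond (p + p) (q + q) ((parityEquiv p).symm a) ((parityEquiv q).symm b) with hsupp
  have hprod : ∀ X₁ X₂ X₃ X₄ : Matrix (Fin p) (Fin q) ℝ,
      fromBlocks X₁ X₂ X₃ X₄ * jordanBlocks x y q - jordanBlocks x y p * fromBlocks X₁ X₂ X₃ X₄ =
      fromBlocks (X₁ * nilJordan q - nilJordan p * X₁ - y • (X₂ + X₃))
        (X₂ * nilJordan q - nilJordan p * X₂ + y • (X₁ - X₄))
        (X₃ * nilJordan q - nilJordan p * X₃ + y • (X₁ - X₄))
        (X₄ * nilJordan q - nilJordan p * X₄ + y • (X₂ + X₃)) := by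
    intro X₁ X₂ X₃ X₄
    rw [jordanBlocks, jordanBlocks, fromBlocks_multiply, fromBlocks_multiply, fromBlocks_sub]
    congr 1 <;>
    · simp only [Matrix.mul_add, Matrix.add_mul, Matrix.mul_smul, Matrix.smul_mul,
        Matrix.mul_one, Matrix.one_mul]
      module
  have hJ := supportCompl_nilJordan_hcond p q
  refine ⟨fun Y => ?_, fun Z X hZ hE => ?_⟩
  · obtain ⟨Z₁, X₁, hZ₁, h₁⟩ := hJ.1 (Y.toBlocks₁₁ + Y.toBlocks₂₂)
    obtain ⟨Z₂, X₂, hZ₂, h₂⟩ := hJ.1 (Y.toBlocks₁₂ - Y.toBlocks₂₁)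
    obtain ⟨U₁, U₂, U₃, U₄, hU, hU₁, hU₂⟩ : ∃ U₁ U₂ U₃ U₄ : Matrix (Fin p) (Fin q) ℝ,
        (∀ a b, ¬ supp a b → fromBlocks U₁ U₂ U₃ U₄ a b = 0) ∧ U₁ + U₄ = Z₁ ∧ U₂ - U₃ = Z₂ := by
      by_cases hpq : p ≤ q
      · refine ⟨Z₁, 0, -Z₂, 0, fun a b hab => ?_, by simp, by simp⟩
        rcases a with a | a <;> rcases b with b | b
        · refine hZ₁ _ _ fun h => hab ?_
          simp only [Hcond, hpq, if_true] at h
          simp [hsupp, Hcond, parityEquiv, h, show p + p ≤ q + q by omega]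
        · rfl
        · refine neg_eq_zero.mpr (hZ₂ _ _ fun h => hab ?_)
          simp only [Hcond, hpq, if_true] at h
          simp [hsupp, Hcond, parityEquiv, h, show p + p ≤ q + q by omega]
        · rfl
      · refine ⟨0, 0, -Z₂, Z₁, fun a b hab => ?_, by simp, by simp⟩
        rcases a with a | a <;> rcases b with b | b
        · rfl
        · rfl
        · refine neg_eq_zero.mpr (hZ₂ _ _ fun h => hab ?_)
          simp only [Hcond, hpq, if_false] at h
          simp [hsupp, Hcond, parityEquiv, h, show ¬ p + p ≤ q + q by omega]
          omega
        · refine hZ₁ _ _ fun h => hab ?_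
          simp only [Hcond, hpq, if_false] at h
          simp [hsupp, Hcond, parityEquiv, h, show ¬ p + p ≤ q + q by omega]
          omega
    have hW : SupportCompl (nilJordan p) (jordanBlocks 0 (2 * y) q) (fun _ _ => False) := by
      have hlam : (⟨0, 2 * y⟩ : ℂ) ≠ 0 := fun h => hy (by simpa using congrArg Complex.im h)
      refine supportCompl_of_isCoprime (isCoprime_X_conjPoly hlam) ?_
        (isNilpotent_aeval_jordanBlocks ⟨0, 2 * y⟩ q)
      simpa using isNilpotent_nilJordan p
    obtain ⟨Z', W, hZ', hW⟩ := hW.1 (fromCols (Y.toBlocks₁₁ - Y.toBlocks₂₂ - (U₁ - U₄))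
      (Y.toBlocks₁₂ + Y.toBlocks₂₁ - (U₂ + U₃)))
    obtain rfl : Z' = 0 := by
      ext a b
      exact hZ' a b id
    obtain ⟨W₁, W₂, rfl⟩ : ∃ W₁ W₂, W = fromCols W₁ W₂ := ⟨_, _, (fromCols_toCols W).symm⟩
    rw [zero_add, jordanBlocks, fromCols_mul_fromBlocks, mul_fromCols] at hW
    have h₃ := congrArg toCols₁ hW
    have h₄ := congrArg toCols₂ hW
    have hs₁ : ∀ V V' : Matrix (Fin p) (Fin q ⊕ Fin q) ℝ,
        toCols₁ (V - V') = toCols₁ V - toCols₁ V' := fun _ _ => rfl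
    have hs₂ : ∀ V V' : Matrix (Fin p) (Fin q ⊕ Fin q) ℝ,
        toCols₂ (V - V') = toCols₂ V - toCols₂ V' := fun _ _ => rfl
    simp only [hs₁, hs₂, toCols₁_fromCols, toCols₂_fromCols, Matrix.mul_smul,
      Matrix.mul_one, zero_smul, add_zero] at h₃ h₄
    refine ⟨fromBlocks U₁ U₂ U₃ U₄,
      fromBlocks ((1 / 2 : ℝ) • (X₁ + W₁)) ((1 / 2 : ℝ) • (X₂ + W₂))
        ((1 / 2 : ℝ) • (W₂ - X₂)) ((1 / 2 : ℝ) • (X₁ - W₁)), hU, ?_⟩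
    rw [hprod, fromBlocks_add]
    conv_lhs => rw [← fromBlocks_toBlocks Y]
    simp only [Matrix.add_mul, Matrix.mul_add, Matrix.sub_mul, Matrix.mul_sub, Matrix.mul_smul,
      Matrix.smul_mul]
    congr 1
    · linear_combination (norm := module) (1 / 2 : ℝ) • h₁ + (1 / 2 : ℝ) • h₃ - (1 / 2 : ℝ) • hU₁
    · linear_combination (norm := module) (1 / 2 : ℝ) • h₂ + (1 / 2 : ℝ) • h₄ - (1 / 2 : ℝ) • hU₂
    · linear_combination (norm := module) (1 / 2 : ℝ) • h₄ - (1 / 2 : ℝ) • h₂ + (1 / 2 : ℝ) • hU₂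
    · linear_combination (norm := module) (1 / 2 : ℝ) • h₁ - (1 / 2 : ℝ) • h₃ - (1 / 2 : ℝ) • hU₁
  · rw [← fromBlocks_toBlocks X, hprod] at hE
    have h11 := congrArg toBlocks₁₁ hE
    have h12 := congrArg toBlocks₁₂ hE
    have h21 := congrArg toBlocks₂₁ hE
    have h22 := congrArg toBlocks₂₂ hE
    rw [← fromBlocks_toBlocks Z, fromBlocks_add, ← fromBlocks_zero] at h11 h12 h21 h22
    simp only [toBlocks_fromBlocks₁₁, toBlocks_fromBlocks₁₂, toBlocks_fromBlocks₂₁,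
      toBlocks_fromBlocks₂₂] at h11 h12 h21 h22
    have hs : ∀ (a : Fin p) (b : Fin q), ¬ Hcond p q a b → Z.toBlocks₁₁ a b = 0 ∧ Z.toBlocks₁₂ a b = 0 ∧
        Z.toBlocks₂₁ a b = 0 ∧ Z.toBlocks₂₂ a b = 0 := by
      intro a b hab
      refine ⟨hZ _ _ fun h => hab ?_, hZ _ _ fun h => hab ?_, hZ _ _ fun h => hab ?_,
        hZ _ _ fun h => hab ?_⟩ <;>
      · simp only [hsupp, Hcond, parityEquiv, Equiv.coe_fn_symm_mk, Sum.elim_inl,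
          Sum.elim_inr] at h ⊢
        split_ifs at h ⊢ <;> omega
    have h₁ := hJ.2 (Z.toBlocks₁₁ + Z.toBlocks₂₂) (X.toBlocks₁₁ + X.toBlocks₂₂)
      (fun a b hab => by simp [hs a b hab]) (by
        rw [Matrix.add_mul, Matrix.mul_add]
        linear_combination (norm := module) h11 + h22)
    have h₂ := hJ.2 (Z.toBlocks₁₂ - Z.toBlocks₂₁) (X.toBlocks₁₂ - X.toBlocks₂₁)
      (fun a b hab => by simp [hs a b hab]) (by
        rw [Matrix.sub_mul, Matrix.mul_sub]
        linear_combination (norm := module) h12 - h21)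
    rw [← fromBlocks_toBlocks Z, ← fromBlocks_zero]
    by_cases hpq : p ≤ q
    · have h3 : Z.toBlocks₁₂ = 0 := by
        ext a b
        refine hZ _ _ fun h => ?_
        simp [hsupp, Hcond, parityEquiv, show p + p ≤ q + q by omega] at h
      have h4 : Z.toBlocks₂₂ = 0 := by
        ext a b
        refine hZ _ _ fun h => ?_
        simp [hsupp, Hcond, parityEquiv, show p + p ≤ q + q by omega] at h
      rw [h4, add_zero] at h₁
      rw [h3, zero_sub, neg_eq_zero] at h₂
      rw [h₁, h₂, h3, h4]
    · have h3 : Z.toBlocks₁₂ = 0 := by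
        ext a b
        refine hZ _ _ fun h => ?_
        simp [hsupp, Hcond, parityEquiv, show ¬ p + p ≤ q + q by omega] at h
        omega
      have h4 : Z.toBlocks₁₁ = 0 := by
        ext a b
        refine hZ _ _ fun h => ?_
        simp [hsupp, Hcond, parityEquiv, show ¬ p + p ≤ q + q by omega] at h
        omega
      rw [h4, zero_add] at h₁
      rw [h3, zero_sub, neg_eq_zero] at h₂
      rw [h₁, h₂, h3, h4]

theorem supportCompl_realJordan {lam : ℂ} {p q : ℕ} (hp : lam.im ≠ 0 → Even p)
    (hq : lam.im ≠ 0 → Even q) :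
    SupportCompl (realJordan lam p) (realJordan lam q) (fun a b => Hcond p q a b) := by
  by_cases hl : lam.im = 0
  · rw [realJordan_of_im_eq_zero hl, realJordan_of_im_eq_zero hl]
    exact (supportCompl_nilJordan_hcond p q).add_smul_one _
  · obtain ⟨p, rfl⟩ := hp hl
    obtain ⟨q, rfl⟩ := hq hl
    rw [realJordan_of_im_ne_zero hl, realJordan_of_im_ne_zero hl]
    refine ((supportCompl_jordanBlocks lam.re hl p q).submatrix _ _).congr fun a b => ?_
    simp

theorem supportCompl_realJordan_of_ne {lam mu : ℂ} {p q : ℕ} (h1 : lam ≠ mu)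
    (h2 : lam ≠ (starRingEnd ℂ) mu) (hp : lam.im ≠ 0 → Even p) (hq : mu.im ≠ 0 → Even q) :
    SupportCompl (realJordan lam p) (realJordan mu q) (fun _ _ => False) :=
  supportCompl_of_isCoprime (isCoprime_conjPoly h1 h2) (isNilpotent_aeval_realJordan hp)
    (isNilpotent_aeval_realJordan hq)

/-- Index set of the nilpotent summands. -/
abbrev NilSummand := Fin t1 ⊕ (Fin t2 ⊕ (Fin t3 ⊕ Fin t4))

/-- Rows of the nilpotent part of `A`. -/
abbrev NilRow := (Σ j : Fin t1, Fin (r1 j)) ⊕ ((Σ j : Fin t2, Fin (r2 j)) ⊕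
  ((Σ j : Fin t3, Fin (r3 j)) ⊕ (Σ j : Fin t4, Fin (r4 j - 1))))

/-- Columns of the nilpotent part of `A`. -/
abbrev NilCol := (Σ j : Fin t1, Fin (r1 j)) ⊕ ((Σ j : Fin t2, Fin (r2 j)) ⊕
  ((Σ j : Fin t3, Fin (r3 j - 1)) ⊕ (Σ j : Fin t4, Fin (r4 j))))

/-- Total dimension of a nilpotent summand, viewed as a chain
`e_{len - 1} ↦ ⋯ ↦ e_1 ↦ e_0 ↦ 0` whose terms alternate between the two spaces. -/
def nilLen : NilSummand t1 t2 t3 t4 → ℕ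
  | Sum.inl j => 2 * r1 j
  | Sum.inr (Sum.inl j) => 2 * r2 j
  | Sum.inr (Sum.inr (Sum.inl j)) => 2 * r3 j - 1
  | Sum.inr (Sum.inr (Sum.inr j)) => 2 * r4 j - 1

/-- Each basis vector of the nilpotent part is a position in exactly one chain. -/
def nilEquiv : NilRow t1 t2 t3 t4 r1 r2 r3 r4 ⊕ NilCol t1 t2 t3 t4 r1 r2 r3 r4 ≃
    Σ k : NilSummand t1 t2 t3 t4, Fin (nilLen t1 t2 t3 t4 r1 r2 r3 r4 k) where
  toFun
    | Sum.inl (Sum.inl ⟨j, a⟩) => ⟨Sum.inl j, ⟨2 * a, by simp only [nilLen]; omega⟩⟩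
    | Sum.inl (Sum.inr (Sum.inl ⟨j, a⟩)) =>
        ⟨Sum.inr (Sum.inl j), ⟨2 * a + 1, by simp only [nilLen]; omega⟩⟩
    | Sum.inl (Sum.inr (Sum.inr (Sum.inl ⟨j, a⟩))) =>
        ⟨Sum.inr (Sum.inr (Sum.inl j)), ⟨2 * a, by simp only [nilLen]; omega⟩⟩
    | Sum.inl (Sum.inr (Sum.inr (Sum.inr ⟨j, a⟩))) =>
        ⟨Sum.inr (Sum.inr (Sum.inr j)), ⟨2 * a + 1, by simp only [nilLen]; omega⟩⟩
    | Sum.inr (Sum.inl ⟨j, a⟩) => ⟨Sum.inl j, ⟨2 * a + 1, by simp only [nilLen]; omega⟩⟩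
    | Sum.inr (Sum.inr (Sum.inl ⟨j, a⟩)) =>
        ⟨Sum.inr (Sum.inl j), ⟨2 * a, by simp only [nilLen]; omega⟩⟩
    | Sum.inr (Sum.inr (Sum.inr (Sum.inl ⟨j, a⟩))) =>
        ⟨Sum.inr (Sum.inr (Sum.inl j)), ⟨2 * a + 1, by simp only [nilLen]; omega⟩⟩
    | Sum.inr (Sum.inr (Sum.inr (Sum.inr ⟨j, a⟩))) =>
        ⟨Sum.inr (Sum.inr (Sum.inr j)), ⟨2 * a, by simp only [nilLen]; omega⟩⟩
  invFun
    | ⟨Sum.inl j, ⟨n, hn⟩⟩ =>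
        if n % 2 = 0 then Sum.inl (Sum.inl ⟨j, ⟨n / 2, by simp only [nilLen] at hn; omega⟩⟩)
        else Sum.inr (Sum.inl ⟨j, ⟨n / 2, by simp only [nilLen] at hn; omega⟩⟩)
    | ⟨Sum.inr (Sum.inl j), ⟨n, hn⟩⟩ =>
        if n % 2 = 0 then
          Sum.inr (Sum.inr (Sum.inl ⟨j, ⟨n / 2, by simp only [nilLen] at hn; omega⟩⟩))
        else Sum.inl (Sum.inr (Sum.inl ⟨j, ⟨n / 2, by simp only [nilLen] at hn; omega⟩⟩))
    | ⟨Sum.inr (Sum.inr (Sum.inl j)), ⟨n, hn⟩⟩ =>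
        if h : n % 2 = 0 then
          Sum.inl (Sum.inr (Sum.inr (Sum.inl ⟨j, ⟨n / 2, by simp only [nilLen] at hn; omega⟩⟩)))
        else
          Sum.inr (Sum.inr (Sum.inr (Sum.inl ⟨j, ⟨n / 2, by simp only [nilLen] at hn; omega⟩⟩)))
    | ⟨Sum.inr (Sum.inr (Sum.inr j)), ⟨n, hn⟩⟩ =>
        if h : n % 2 = 0 then
          Sum.inr (Sum.inr (Sum.inr (Sum.inr ⟨j, ⟨n / 2, by simp only [nilLen] at hn; omega⟩⟩)))
        else
          Sum.inl (Sum.inr (Sum.inr (Sum.inr ⟨j, ⟨n / 2, by simp only [nilLen] at hn; omega⟩⟩)))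
  left_inv x := by
    have h (n : ℕ) : (2 * n + 1) / 2 = n := by omega
    rcases x with (⟨j, a⟩ | ⟨j, a⟩ | ⟨j, a⟩ | ⟨j, a⟩) | (⟨j, a⟩ | ⟨j, a⟩ | ⟨j, a⟩ | ⟨j, a⟩) <;>
      simp [Nat.add_mod, h]
  right_inv x := by
    rcases x with ⟨j | j | j | j, ⟨n, hn⟩⟩ <;> dsimp only <;> split_ifs <;>
    · simp
      omega

/-- Support of the deformation restricted to the nilpotent part, as a condition on two chains
and two positions; pairs of positions in the same space are governed by `Hcond`. -/
def nilSupp : (k k' : NilSummand t1 t2 t3 t4) → ℕ → ℕ → Prop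
  | Sum.inl j, Sum.inl j', a, b =>
      if (a + b) % 2 = 0 then Hcond (2 * r1 j) (2 * r1 j') a b
      else a % 2 = 1 ∧ Hcond (r1 j) (r1 j') (a / 2) (b / 2)
  | Sum.inl j, Sum.inr (Sum.inl j'), a, b =>
      if (a + b) % 2 = 1 then Hcond (2 * r1 j) (2 * r2 j') a b
      else a % 2 = 1 ∧ Hcond (r1 j) (r2 j') (a / 2) (b / 2)
  | Sum.inl j, Sum.inr (Sum.inr (Sum.inl j')), a, b =>
      if (a + b) % 2 = 0 then Hcond (2 * r1 j) (2 * r3 j' - 1) a b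
      else a % 2 = 1 ∧ Hcond (r1 j) (r3 j') (a / 2) (b / 2)
  | Sum.inl j, Sum.inr (Sum.inr (Sum.inr j')), a, b =>
      if (a + b) % 2 = 1 then Hcond (2 * r1 j) (2 * r4 j' - 1) a b
      else a % 2 = 1 ∧ Hcond (r1 j) (r4 j' - 1) (a / 2) (b / 2)
  | Sum.inr (Sum.inl j), Sum.inl j', a, b =>
      if (a + b) % 2 = 1 then Hcond (2 * r2 j) (2 * r1 j') a b
      else a % 2 = 0 ∧ Hcond (r2 j) (r1 j') (a / 2) (b / 2)
  | Sum.inr (Sum.inl j), Sum.inr (Sum.inl j'), a, b =>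
      if (a + b) % 2 = 0 then Hcond (2 * r2 j) (2 * r2 j') a b
      else a % 2 = 1 ∧ Hcond (r2 j) (r2 j') (a / 2) (b / 2)
  | Sum.inr (Sum.inl j), Sum.inr (Sum.inr (Sum.inl j')), a, b =>
      if (a + b) % 2 = 1 then Hcond (2 * r2 j) (2 * r3 j' - 1) a b
      else a % 2 = 1 ∧ Hcond (r2 j) (r3 j' - 1) (a / 2) (b / 2)
  | Sum.inr (Sum.inl j), Sum.inr (Sum.inr (Sum.inr j')), a, b =>
      if (a + b) % 2 = 0 then Hcond (2 * r2 j) (2 * r4 j' - 1) a b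
      else a % 2 = 1 ∧ Hcond (r2 j) (r4 j') (a / 2) (b / 2)
  | Sum.inr (Sum.inr (Sum.inl j)), Sum.inl j', a, b =>
      if (a + b) % 2 = 0 then Hcond (2 * r3 j - 1) (2 * r1 j') a b
      else a % 2 = 1 ∧ Hcond (r3 j - 1) (r1 j') (a / 2) (b / 2)
  | Sum.inr (Sum.inr (Sum.inl j)), Sum.inr (Sum.inl j'), a, b =>
      if (a + b) % 2 = 1 then Hcond (2 * r3 j - 1) (2 * r2 j') a b
      else a % 2 = 0 ∧ Hcond (r3 j) (r2 j') (a / 2) (b / 2)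
  | Sum.inr (Sum.inr (Sum.inl j)), Sum.inr (Sum.inr (Sum.inl j')), a, b =>
      if (a + b) % 2 = 0 then Hcond (2 * r3 j - 1) (2 * r3 j' - 1) a b
      else (a % 2 = 0 ∧ (j : ℕ) ≤ j' ∧ Hcond (r3 j) (r3 j' - 1) (a / 2) (b / 2)) ∨
        (a % 2 = 1 ∧ (j' : ℕ) < j ∧ Hcond (r3 j - 1) (r3 j') (a / 2) (b / 2))
  | Sum.inr (Sum.inr (Sum.inl j)), Sum.inr (Sum.inr (Sum.inr j')), a, b =>
      if (a + b) % 2 = 1 then Hcond (2 * r3 j - 1) (2 * r4 j' - 1) a b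
      else a % 2 = 0 ∧ Hcond (r3 j) (r4 j') (a / 2) (b / 2)
  | Sum.inr (Sum.inr (Sum.inr j)), Sum.inl j', a, b =>
      if (a + b) % 2 = 1 then Hcond (2 * r4 j - 1) (2 * r1 j') a b
      else a % 2 = 0 ∧ Hcond (r4 j) (r1 j') (a / 2) (b / 2)
  | Sum.inr (Sum.inr (Sum.inr j)), Sum.inr (Sum.inl j'), a, b =>
      if (a + b) % 2 = 0 then Hcond (2 * r4 j - 1) (2 * r2 j') a b
      else a % 2 = 1 ∧ Hcond (r4 j - 1) (r2 j') (a / 2) (b / 2)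
  | Sum.inr (Sum.inr (Sum.inr j)), Sum.inr (Sum.inr (Sum.inl j')), a, b =>
      if (a + b) % 2 = 1 then Hcond (2 * r4 j - 1) (2 * r3 j' - 1) a b
      else a % 2 = 0 ∧ Hcond (r4 j) (r3 j') (a / 2) (b / 2)
  | Sum.inr (Sum.inr (Sum.inr j)), Sum.inr (Sum.inr (Sum.inr j')), a, b =>
      if (a + b) % 2 = 0 then Hcond (2 * r4 j - 1) (2 * r4 j' - 1) a b
      else (a % 2 = 1 ∧ (j' : ℕ) < j ∧ Hcond (r4 j - 1) (r4 j') (a / 2) (b / 2)) ∨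
        (a % 2 = 0 ∧ (j : ℕ) ≤ j' ∧ Hcond (r4 j) (r4 j' - 1) (a / 2) (b / 2))


/-- Support conditions on `nilJordan` blocks whose positions alternate between two spaces:
`c` and `d` are the parities of the row and column positions in the `x × y` sub-block on which
the support is prescribed, and `ρ` is the parity of `a + b` on the remaining diagonals. -/
theorem supportCompl_nilJordan_alternating (p q : ℕ) {x y c d ρ : ℕ} (hc : c < 2) (hd : d < 2)
    (hρ : ρ < 2) (hsum : (c + d + ρ) % 2 = 1) (hx : 2 * x + c = p ∨ 2 * x + c = p + 1)
    (hle : x ≤ y → d ≤ c ∧ p + d ≤ q + c ∧ (d = 1 → p % 2 = 0))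
    (hlt : y < x → (2 * y + d = q ∨ 2 * y + d = q + 1) ∧
      (2 * x + c = p → 2 * y + d = q ∧ d = 0)) :
    SupportCompl (nilJordan p) (nilJordan q) (fun a b =>
      if (a + b : ℕ) % 2 = ρ then Hcond p q a b
      else (a : ℕ) % 2 = c ∧ Hcond x y ((a : ℕ) / 2) ((b : ℕ) / 2)) := by
  unfold Hcond
  refine supportCompl_nilJordan _ (fun a b h => ?_) (fun a b a' b' h h' he => ?_)
    fun e he hpq => ?_
  · split_ifs at h <;> omega
  · rw [Fin.ext_iff, Fin.ext_iff]
    split_ifs at h h' <;> omega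
  · by_cases hpar : e % 2 = ρ
    · by_cases hpq' : p ≤ q
      · refine ⟨⟨e, he⟩, ⟨0, by omega⟩, ?_, by simp⟩
        simp [hpar, hpq']
      · refine ⟨⟨p - 1, by omega⟩, ⟨p - 1 - e, by omega⟩, ?_, by simp only; omega⟩
        have : (p - 1 + (p - 1 - e)) % 2 = ρ := by omega
        simp [this, hpq']
    · by_cases hxy : x ≤ y
      · refine ⟨⟨e + d, by omega⟩, ⟨d, by omega⟩, ?_, rfl.trans (add_comm _ _)⟩
        simp only [if_pos hxy]
        rw [if_neg (by omega)]
        omega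
      · refine ⟨⟨2 * (x - 1) + c, by omega⟩, ⟨2 * (x - 1) + c - e, by omega⟩, ?_,
          by simp only; omega⟩
        simp only [if_neg hxy]
        rw [if_neg (by omega)]
        omega

theorem supportCompl_nilSupp (hr3m : ∀ j j' : Fin t3, j ≤ j' → r3 j' ≤ r3 j)
    (hr3 : ∀ j, 1 ≤ r3 j) (hr4 : ∀ j, 1 ≤ r4 j)
    (hr4m : ∀ j j' : Fin t4, j ≤ j' → r4 j' ≤ r4 j) (k k' : NilSummand t1 t2 t3 t4) :
    SupportCompl (nilJordan (nilLen t1 t2 t3 t4 r1 r2 r3 r4 k))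
      (nilJordan (nilLen t1 t2 t3 t4 r1 r2 r3 r4 k'))
      (fun a b => nilSupp t1 t2 t3 t4 r1 r2 r3 r4 k k' a b) := by
  rcases k with j | j | j | j <;> rcases k' with j' | j' | j' | j' <;>
    simp only [nilLen, nilSupp]
  case inr.inr.inl.inr.inr.inl =>
    have := hr3 j
    have := hr3 j'
    rcases le_or_gt j j' with h | h
    · have := hr3m _ _ h
      refine (supportCompl_nilJordan_alternating _ _ (x := r3 j) (y := r3 j' - 1) (c := 0)
        (d := 1) (ρ := 0) ?_ ?_ ?_ ?_ ?_ ?_ ?_).congr (fun a b => by simp [h, h.not_gt]) <;> omega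
    · have := hr3m _ _ h.le
      refine (supportCompl_nilJordan_alternating _ _ (x := r3 j - 1) (y := r3 j') (c := 1)
        (d := 0) (ρ := 0) ?_ ?_ ?_ ?_ ?_ ?_ ?_).congr (fun a b => by simp [h, h.not_ge]) <;> omega
  case inr.inr.inr.inr.inr.inr =>
    have := hr4 j
    have := hr4 j'
    rcases le_or_gt j j' with h | h
    · have := hr4m _ _ h
      refine (supportCompl_nilJordan_alternating _ _ (x := r4 j) (y := r4 j' - 1) (c := 0)
        (d := 1) (ρ := 0) ?_ ?_ ?_ ?_ ?_ ?_ ?_).congr (fun a b => by simp [h, h.not_gt]) <;> omega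
    · have := hr4m _ _ h.le
      refine (supportCompl_nilJordan_alternating _ _ (x := r4 j - 1) (y := r4 j') (c := 1)
        (d := 0) (ρ := 0) ?_ ?_ ?_ ?_ ?_ ?_ ?_).congr (fun a b => by simp [h, h.not_ge]) <;> omega
  all_goals
    try have := hr3 j
    try have := hr3 j'
    try have := hr4 j
    try have := hr4 j'
    first
      | refine supportCompl_nilJordan_alternating _ _ (d := 0) ?_ ?_ ?_ ?_ ?_ ?_ ?_ <;> omega
      | refine supportCompl_nilJordan_alternating _ _ (d := 1) ?_ ?_ ?_ ?_ ?_ ?_ ?_ <;> omega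

theorem blockDiagonal'_nilJordan_apply {ι : Type*} [DecidableEq ι] (len : ι → ℕ)
    (x y : Σ k, Fin (len k)) :
    blockDiagonal' (fun k => nilJordan (len k)) x y =
      if x.1 = y.1 ∧ (x.2 : ℕ) + 1 = y.2 then 1 else 0 := by
  obtain ⟨k, a⟩ := x
  obtain ⟨k', b⟩ := y
  by_cases h : k = k'
  · subst h
    simp [blockDiagonal'_apply_eq, nilJordan, eq_comm]
  · simp [blockDiagonal'_apply_ne _ _ _ h, h]

theorem fromBlocks_toBlocks₂₂_eq_submatrix_nilJordan :
    fromBlocks 0 (A t1 t2 t3 t4 r1 r2 r3 r4 s tC szC).toBlocks₂₂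
      (B t1 t2 t3 t4 r1 r2 r3 r4 s lamC tC szC).toBlocks₂₂ 0 =
    (blockDiagonal' fun k => nilJordan (nilLen t1 t2 t3 t4 r1 r2 r3 r4 k)).submatrix
      (nilEquiv t1 t2 t3 t4 r1 r2 r3 r4) (nilEquiv t1 t2 t3 t4 r1 r2 r3 r4) := by
  have h2 (a b : ℕ) : 2 * a + 1 + 1 = 2 * b ↔ b = a + 1 := by omega
  have h3 (a b : ℕ) : 2 * a + 1 ≠ 2 * b := by omega
  ext x y
  rw [submatrix_apply, blockDiagonal'_nilJordan_apply]
  rcases x with u | u <;> rcases y with v | v <;>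
  rcases u with ⟨j, a⟩ | ⟨j, a⟩ | ⟨j, a⟩ | ⟨j, a⟩ <;>
  rcases v with ⟨j', b⟩ | ⟨j', b⟩ | ⟨j', b⟩ | ⟨j', b⟩ <;>
  dsimp only [A, B, toBlocks₂₂, of_apply, fromBlocks_apply₁₁, fromBlocks_apply₁₂,
    fromBlocks_apply₂₁, fromBlocks_apply₂₂] <;>
  simp [nilEquiv, h2, h3]

theorem supportCompl_fromBlocks_toBlocks₂₂
    (hr3 : ∀ j, 1 ≤ r3 j) (hr3m : ∀ j j' : Fin t3, j ≤ j' → r3 j' ≤ r3 j)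
    (hr4 : ∀ j, 1 ≤ r4 j) (hr4m : ∀ j j' : Fin t4, j ≤ j' → r4 j' ≤ r4 j) :
    SupportCompl
      (fromBlocks 0 (A t1 t2 t3 t4 r1 r2 r3 r4 s tC szC).toBlocks₂₂
        (B t1 t2 t3 t4 r1 r2 r3 r4 s lamC tC szC).toBlocks₂₂ 0)
      (fromBlocks 0 (A t1 t2 t3 t4 r1 r2 r3 r4 s tC szC).toBlocks₂₂
        (B t1 t2 t3 t4 r1 r2 r3 r4 s lamC tC szC).toBlocks₂₂ 0)
      (fun x y => nilSupp t1 t2 t3 t4 r1 r2 r3 r4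
        (nilEquiv t1 t2 t3 t4 r1 r2 r3 r4 x).1 (nilEquiv t1 t2 t3 t4 r1 r2 r3 r4 y).1
        (nilEquiv t1 t2 t3 t4 r1 r2 r3 r4 x).2 (nilEquiv t1 t2 t3 t4 r1 r2 r3 r4 y).2) := by
  rw [fromBlocks_toBlocks₂₂_eq_submatrix_nilJordan]
  exact (SupportCompl.blockDiagonal' (fun k => nilJordan (nilLen t1 t2 t3 t4 r1 r2 r3 r4 k))
    (fun x y => nilSupp t1 t2 t3 t4 r1 r2 r3 r4 x.1 y.1 x.2 y.2)
    fun k k' => supportCompl_nilSupp t1 t2 t3 t4 r1 r2 r3 r4 hr3m hr3 hr4 hr4m k k').submatrix _ _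

theorem nilSupp_nilEquiv_inl_inr (u : NilRow t1 t2 t3 t4 r1 r2 r3 r4)
    (v : NilCol t1 t2 t3 t4 r1 r2 r3 r4) :
    nilSupp t1 t2 t3 t4 r1 r2 r3 r4
        (nilEquiv t1 t2 t3 t4 r1 r2 r3 r4 (Sum.inl u)).1
        (nilEquiv t1 t2 t3 t4 r1 r2 r3 r4 (Sum.inr v)).1
        (nilEquiv t1 t2 t3 t4 r1 r2 r3 r4 (Sum.inl u)).2
        (nilEquiv t1 t2 t3 t4 r1 r2 r3 r4 (Sum.inr v)).2 ↔
      PSupp t1 t2 t3 t4 r1 r2 r3 r4 s tC szC (Sum.inr u) (Sum.inr v) := by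
  have h2 (a : ℕ) : (2 * a + 1) / 2 = a := by omega
  rcases u with ⟨j, a⟩ | ⟨j, a⟩ | ⟨j, a⟩ | ⟨j, a⟩ <;>
  rcases v with ⟨j', b⟩ | ⟨j', b⟩ | ⟨j', b⟩ | ⟨j', b⟩ <;>
  simp [nilEquiv, nilSupp, PSupp, h2, Nat.add_mod]

theorem nilSupp_nilEquiv_inr_inl (u : NilRow t1 t2 t3 t4 r1 r2 r3 r4)
    (v : NilCol t1 t2 t3 t4 r1 r2 r3 r4) :
    nilSupp t1 t2 t3 t4 r1 r2 r3 r4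
        (nilEquiv t1 t2 t3 t4 r1 r2 r3 r4 (Sum.inr v)).1
        (nilEquiv t1 t2 t3 t4 r1 r2 r3 r4 (Sum.inl u)).1
        (nilEquiv t1 t2 t3 t4 r1 r2 r3 r4 (Sum.inr v)).2
        (nilEquiv t1 t2 t3 t4 r1 r2 r3 r4 (Sum.inl u)).2 ↔
      QSupp t1 t2 t3 t4 r1 r2 r3 r4 s tC szC (Sum.inr v) (Sum.inr u) := by
  have h2 (a : ℕ) : (2 * a + 1) / 2 = a := by omega
  rcases u with ⟨j, a⟩ | ⟨j, a⟩ | ⟨j, a⟩ | ⟨j, a⟩ <;>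
  rcases v with ⟨j', b⟩ | ⟨j', b⟩ | ⟨j', b⟩ | ⟨j', b⟩ <;>
  simp [nilEquiv, nilSupp, QSupp, h2, Nat.add_mod]

theorem isNilpotent_fromBlocks_toBlocks₂₂ :
    IsNilpotent (fromBlocks 0 (A t1 t2 t3 t4 r1 r2 r3 r4 s tC szC).toBlocks₂₂
      (B t1 t2 t3 t4 r1 r2 r3 r4 s lamC tC szC).toBlocks₂₂ 0) := by
  rw [fromBlocks_toBlocks₂₂_eq_submatrix_nilJordan]
  refine isNilpotent_of_weight (fun x => ((nilEquiv t1 t2 t3 t4 r1 r2 r3 r4 x).2 : ℕ))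
    fun x y h => ?_
  rw [submatrix_apply, blockDiagonal'_nilJordan_apply] at h
  have := (ite_ne_right_iff.mp h).1.2
  omega

theorem B_toBlocks₁₁_eq_submatrix_realJordan :
    (B t1 t2 t3 t4 r1 r2 r3 r4 s lamC tC szC).toBlocks₁₁ =
    (blockDiagonal' fun k : Σ i, Fin (tC i) => realJordan (lamC k.1) (szC k.1 k.2)).submatrix
      (Equiv.sigmaAssoc _).symm (Equiv.sigmaAssoc _).symm := by
  ext ⟨i, j, a⟩ ⟨i', j', b⟩
  dsimp only [toBlocks₁₁, B, of_apply, submatrix_apply, Equiv.sigmaAssoc, Equiv.coe_fn_symm_mk]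
  by_cases h : (⟨i, j⟩ : Σ i, Fin (tC i)) = ⟨i', j'⟩
  · cases h
    simp [blockDiagonal'_apply_eq, realJordan]
  · rw [blockDiagonal'_apply_ne _ _ _ h, if_neg]
    rintro ⟨rfl, h'⟩
    exact h (by rw [Fin.ext h'])

theorem supportCompl_B_toBlocks₁₁ (hlam : Function.Injective lamC)
    (him : ∀ i, 0 ≤ (lamC i).im)
    (heven : ∀ (i : Fin s) (j : Fin (tC i)), 0 < (lamC i).im → Even (szC i j)) :
    SupportCompl (B t1 t2 t3 t4 r1 r2 r3 r4 s lamC tC szC).toBlocks₁₁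
      (B t1 t2 t3 t4 r1 r2 r3 r4 s lamC tC szC).toBlocks₁₁
      (fun c c' => QSupp t1 t2 t3 t4 r1 r2 r3 r4 s tC szC (Sum.inl c) (Sum.inl c')) := by
  rw [B_toBlocks₁₁_eq_submatrix_realJordan]
  have hev (i : Fin s) (j : Fin (tC i)) (h : (lamC i).im ≠ 0) : Even (szC i j) :=
    heven i j (lt_of_le_of_ne (him i) h.symm)
  refine (SupportCompl.blockDiagonal'
    (fun k : Σ i, Fin (tC i) => realJordan (lamC k.1) (szC k.1 k.2))
    (fun x y => x.1.1 = y.1.1 ∧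
      Hcond (szC x.1.1 x.1.2) (szC y.1.1 y.1.2) x.2 y.2) ?_).submatrix _ _
  rintro ⟨i, j⟩ ⟨i', j'⟩
  by_cases h : i = i'
  · subst h
    exact (supportCompl_realJordan (hev i j) (hev i j')).congr (by simp)
  · refine (supportCompl_realJordan_of_ne (hlam.ne h) (fun hc => h (hlam ?_))
      (hev i j) (hev i' j')).congr (by simp [h])
    have h1 := him i
    have h2 := him i'
    have h3 := congrArg Complex.im hc
    have h4 := congrArg Complex.re hc
    simp only [Complex.conj_im, Complex.conj_re] at h3 h4
    exact Complex.ext h4 (by linarith)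

theorem isUnit_B_toBlocks₁₁ (hlam0 : ∀ i, lamC i ≠ 0) (him : ∀ i, 0 ≤ (lamC i).im)
    (heven : ∀ (i : Fin s) (j : Fin (tC i)), 0 < (lamC i).im → Even (szC i j)) :
    IsUnit (B t1 t2 t3 t4 r1 r2 r3 r4 s lamC tC szC).toBlocks₁₁ := by
  rw [B_toBlocks₁₁_eq_submatrix_realJordan]
  rw [isUnit_submatrix_equiv]
  refine IsUnit.map (blockDiagonal'RingHom (fun k : Σ i, Fin (tC i) => Fin (szC k.1 k.2)) ℝ)
    (Pi.isUnit_iff.mpr fun k => isUnit_realJordan (hlam0 _) fun h =>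
      heven _ _ (lt_of_le_of_ne (him _) h.symm))

/-- Reduction of the decomposition problem for `A = 1 ⊕ A'`, `B = C ⊕ B'`, with `C` invertible
and `A' B'` nilpotent, to Sylvester operators. -/
theorem contragredient_decomposition {k r c : Type*} [Fintype k] [Fintype r] [Fintype c]
    [DecidableEq k] [DecidableEq r] [DecidableEq c] {C : Matrix k k ℝ} {A' : Matrix r c ℝ}
    {B' : Matrix c r ℝ} {suppC : k → k → Prop} {suppT : r ⊕ c → r ⊕ c → Prop}
    {p : k ⊕ r → k ⊕ c → Prop} {q : k ⊕ c → k ⊕ r → Prop}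
    (hC : SupportCompl C C suppC) (hCu : IsUnit C)
    (hT : SupportCompl (fromBlocks 0 A' B' 0) (fromBlocks 0 A' B' 0) suppT)
    (hTn : IsNilpotent (fromBlocks 0 A' B' 0))
    (hp₁ : ∀ x v, ¬ p (Sum.inl x) v) (hp₂₁ : ∀ u x, ¬ p (Sum.inr u) (Sum.inl x))
    (hp₂₂ : ∀ u v, p (Sum.inr u) (Sum.inr v) ↔ suppT (Sum.inl u) (Sum.inr v))
    (hq₁₁ : ∀ x y, q (Sum.inl x) (Sum.inl y) ↔ suppC x y)
    (hq₁₂ : ∀ x u, ¬ q (Sum.inl x) (Sum.inr u)) (hq₂₁ : ∀ v x, ¬ q (Sum.inr v) (Sum.inl x))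
    (hq₂₂ : ∀ u v, q (Sum.inr v) (Sum.inr u) ↔ suppT (Sum.inr v) (Sum.inl u)) :
    (∀ (M : Matrix (k ⊕ r) (k ⊕ c) ℝ) (N : Matrix (k ⊕ c) (k ⊕ r) ℝ),
      ∃ (P : Matrix (k ⊕ r) (k ⊕ c) ℝ) (Q : Matrix (k ⊕ c) (k ⊕ r) ℝ)
        (S : Matrix (k ⊕ r) (k ⊕ r) ℝ) (R : Matrix (k ⊕ c) (k ⊕ c) ℝ),
      (∀ x y, ¬ p x y → P x y = 0) ∧ (∀ x y, ¬ q x y → Q x y = 0) ∧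
      M = P + (S * fromBlocks (1 : Matrix k k ℝ) 0 0 A' - fromBlocks (1 : Matrix k k ℝ) 0 0 A' * R) ∧
      N = Q + (R * fromBlocks C 0 0 B' - fromBlocks C 0 0 B' * S)) ∧
    (∀ (P : Matrix (k ⊕ r) (k ⊕ c) ℝ) (Q : Matrix (k ⊕ c) (k ⊕ r) ℝ)
      (S : Matrix (k ⊕ r) (k ⊕ r) ℝ) (R : Matrix (k ⊕ c) (k ⊕ c) ℝ), (∀ x y, ¬ p x y → P x y = 0) → (∀ x y, ¬ q x y → Q x y = 0) →
      P + (S * fromBlocks (1 : Matrix k k ℝ) 0 0 A' - fromBlocks (1 : Matrix k k ℝ) 0 0 A' * R) = 0 →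
      Q + (R * fromBlocks C 0 0 B' - fromBlocks C 0 0 B' * S) = 0 →
      P = 0 ∧ Q = 0) := by
  have hsq : IsNilpotent (fromBlocks (A' * B') 0 0 (B' * A')) := by
    have := hTn.pow_of_pos two_ne_zero
    rw [sq, fromBlocks_multiply] at this
    simpa using this
  have hpow (n : ℕ) : fromBlocks (A' * B') 0 0 (B' * A') ^ n =
      fromBlocks ((A' * B') ^ n) 0 0 ((B' * A') ^ n) := by
    induction n with
    | zero => simp
    | succ n ih => simp [pow_succ, ih, fromBlocks_multiply]
  obtain ⟨n, hn⟩ := hsq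
  rw [hpow, ← fromBlocks_zero, fromBlocks_inj] at hn
  have hAB : IsNilpotent (A' * B') := ⟨n, hn.1⟩
  have hBA : IsNilpotent (B' * A') := ⟨n, hn.2.2.2⟩
  have h12 : SupportCompl C (A' * B') (fun _ _ => False) :=
    supportCompl_of_injective fun X h => eq_zero_of_mul_eq_mul_of_isUnit_left hCu hAB h
  have h21 : SupportCompl (B' * A') C (fun _ _ => False) :=
    supportCompl_of_injective fun X h => eq_zero_of_mul_eq_mul_of_isUnit_right hBA hCu h
  refine ⟨fun M N => ?_, fun P Q S R hP hQ h1 h2 => ?_⟩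
  · obtain ⟨Q₁₁, S₁₁, hQ₁₁, e₁₁⟩ := hC.1 (N.toBlocks₁₁ + M.toBlocks₁₁ * C)
    obtain ⟨Z₁₂, S₁₂, hZ₁₂, e₁₂⟩ := h12.1 (N.toBlocks₁₂ + M.toBlocks₁₂ * B')
    obtain ⟨Z₂₁, R₂₁, hZ₂₁, e₂₁⟩ := h21.1 (N.toBlocks₂₁ + B' * M.toBlocks₂₁)
    obtain ⟨Z, X, hZ, e₂₂⟩ := hT.1 (fromBlocks 0 M.toBlocks₂₂ N.toBlocks₂₂ 0)
    obtain rfl : Z₁₂ = 0 := by ext a b; exact hZ₁₂ a b id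
    obtain rfl : Z₂₁ = 0 := by ext a b; exact hZ₂₁ a b id
    rw [← fromBlocks_toBlocks X, ← fromBlocks_toBlocks Z, fromBlocks_multiply,
      fromBlocks_multiply, fromBlocks_sub, fromBlocks_add, fromBlocks_inj] at e₂₂
    obtain ⟨-, eM, eN, -⟩ := e₂₂
    refine ⟨fromBlocks 0 0 0 Z.toBlocks₁₂, fromBlocks Q₁₁ 0 0 Z.toBlocks₂₁,
      fromBlocks S₁₁ S₁₂ (M.toBlocks₂₁ + A' * R₂₁) X.toBlocks₁₁,
      fromBlocks (S₁₁ - M.toBlocks₁₁) (S₁₂ * A' - M.toBlocks₁₂) R₂₁ X.toBlocks₂₂, ?_, ?_, ?_, ?_⟩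
    · rintro (x | u) (y | v) h
      · rfl
      · rfl
      · rfl
      · exact hZ _ _ (mt (hp₂₂ u v).mpr h)
    · rintro (x | v) (y | u) h
      · exact hQ₁₁ _ _ (mt (hq₁₁ x y).mpr h)
      · rfl
      · rfl
      · exact hZ _ _ (mt (hq₂₂ u v).mpr h)
    · conv_lhs => rw [← fromBlocks_toBlocks M]
      rw [fromBlocks_multiply, fromBlocks_multiply, fromBlocks_sub, fromBlocks_add, fromBlocks_inj]
      simpa using eM
    · conv_lhs => rw [← fromBlocks_toBlocks N]
      rw [fromBlocks_multiply, fromBlocks_multiply, fromBlocks_sub, fromBlocks_add, fromBlocks_inj]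
      simp only [Matrix.mul_zero, Matrix.zero_mul, add_zero, zero_add, Matrix.sub_mul,
        Matrix.mul_add, Matrix.mul_assoc] at e₁₁ e₁₂ e₂₁ eN ⊢
      refine ⟨?_, ?_, ?_, eN⟩
      · linear_combination (norm := module) e₁₁
      · linear_combination (norm := module) e₁₂
      · linear_combination (norm := module) e₂₁
  · rw [← fromBlocks_toBlocks P, ← fromBlocks_toBlocks S, ← fromBlocks_toBlocks R,
      fromBlocks_multiply, fromBlocks_multiply, fromBlocks_sub, fromBlocks_add,
      ← fromBlocks_zero, fromBlocks_inj] at h1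
    rw [← fromBlocks_toBlocks Q, ← fromBlocks_toBlocks S, ← fromBlocks_toBlocks R,
      fromBlocks_multiply, fromBlocks_multiply, fromBlocks_sub, fromBlocks_add,
      ← fromBlocks_zero, fromBlocks_inj] at h2
    have hP₁₁ : P.toBlocks₁₁ = 0 := by ext a b; exact hP _ _ (hp₁ _ _)
    have hQ₁₁ : Q.toBlocks₁₁ = 0 := by
      refine hC.2 _ S.toBlocks₁₁ (fun a b h => hQ _ _ (mt (hq₁₁ a b).mp h)) ?_
      have e1 := h1.1
      have e2 := h2.1
      simp only [hP₁₁, Matrix.mul_zero, Matrix.zero_mul, add_zero, zero_add, Matrix.mul_one,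
        Matrix.one_mul, sub_eq_zero] at e1 e2
      rwa [← e1] at e2
    have hZ : fromBlocks 0 P.toBlocks₂₂ Q.toBlocks₂₂ 0 = 0 := by
      refine hT.2 _ (fromBlocks S.toBlocks₂₂ 0 0 R.toBlocks₂₂) ?_ ?_
      · rintro (u | v) (u' | v') h
        · rfl
        · exact hP _ _ (mt (hp₂₂ u v').mp h)
        · exact hQ _ _ (mt (hq₂₂ u' v).mp h)
        · rfl
      · have e1 := h1.2.2.2
        have e2 := h2.2.2.2
        rw [fromBlocks_multiply, fromBlocks_multiply, fromBlocks_sub, fromBlocks_add,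
          ← fromBlocks_zero, fromBlocks_inj]
        simpa using And.intro e1 e2
    rw [← fromBlocks_zero, fromBlocks_inj] at hZ
    constructor
    · ext (x | u) (y | v)
      · exact hP _ _ (hp₁ _ _)
      · exact hP _ _ (hp₁ _ _)
      · exact hP _ _ (hp₂₁ _ _)
      · exact congrFun₂ hZ.2.1 u v
    · ext (x | v) (y | u)
      · exact congrFun₂ hQ₁₁ x y
      · exact hQ _ _ (hq₁₂ _ _)
      · exact hQ _ _ (hq₂₁ _ _)
      · exact congrFun₂ hZ.2.2.1 v u

/-- Theorem 4.1 of the paper over `ℝ`: `ℝ^{m×n} × ℝ^{n×m}` is the internal direct sum of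
the coordinate subspace `𝒫` (supported on `PSupp`, `QSupp`) and the tangent space
`{(SA − AR, RB − BS)}`: every pair `(M, N)` decomposes, uniquely, as a sum of the two. -/
theorem simplest_miniversal_contragredient_real
    (hlam : Function.Injective lamC) (hlam0 : ∀ i, lamC i ≠ 0)
    (him : ∀ i, 0 ≤ (lamC i).im)
    (heven : ∀ (i : Fin s) (j : Fin (tC i)), 0 < (lamC i).im → Even (szC i j))
    (hszC1 : ∀ i j, 1 ≤ szC i j)
    (hszCmono : ∀ (i : Fin s) (j j' : Fin (tC i)), j ≤ j' → szC i j' ≤ szC i j)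
    (hr1 : ∀ j, 1 ≤ r1 j) (hr1m : ∀ j j' : Fin t1, j ≤ j' → r1 j' ≤ r1 j)
    (hr2 : ∀ j, 1 ≤ r2 j) (hr2m : ∀ j j' : Fin t2, j ≤ j' → r2 j' ≤ r2 j)
    (hr3 : ∀ j, 1 ≤ r3 j) (hr3m : ∀ j j' : Fin t3, j ≤ j' → r3 j' ≤ r3 j)
    (hr4 : ∀ j, 1 ≤ r4 j) (hr4m : ∀ j j' : Fin t4, j ≤ j' → r4 j' ≤ r4 j) :
    (∀ (M : Matrix (Mi t1 t2 t3 t4 r1 r2 r3 r4 s tC szC) (Ni t1 t2 t3 t4 r1 r2 r3 r4 s tC szC) ℝ)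
       (N : Matrix (Ni t1 t2 t3 t4 r1 r2 r3 r4 s tC szC) (Mi t1 t2 t3 t4 r1 r2 r3 r4 s tC szC) ℝ),
      ∃ (P : Matrix (Mi t1 t2 t3 t4 r1 r2 r3 r4 s tC szC) (Ni t1 t2 t3 t4 r1 r2 r3 r4 s tC szC) ℝ)
        (Q : Matrix (Ni t1 t2 t3 t4 r1 r2 r3 r4 s tC szC) (Mi t1 t2 t3 t4 r1 r2 r3 r4 s tC szC) ℝ)
        (S : Matrix (Mi t1 t2 t3 t4 r1 r2 r3 r4 s tC szC) (Mi t1 t2 t3 t4 r1 r2 r3 r4 s tC szC) ℝ)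
        (R : Matrix (Ni t1 t2 t3 t4 r1 r2 r3 r4 s tC szC) (Ni t1 t2 t3 t4 r1 r2 r3 r4 s tC szC) ℝ),
        (∀ x y, ¬ PSupp t1 t2 t3 t4 r1 r2 r3 r4 s tC szC x y → P x y = 0) ∧
        (∀ x y, ¬ QSupp t1 t2 t3 t4 r1 r2 r3 r4 s tC szC x y → Q x y = 0) ∧
        M = P + (S * A t1 t2 t3 t4 r1 r2 r3 r4 s tC szC
                  - A t1 t2 t3 t4 r1 r2 r3 r4 s tC szC * R) ∧
        N = Q + (R * B t1 t2 t3 t4 r1 r2 r3 r4 s lamC tC szC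
                  - B t1 t2 t3 t4 r1 r2 r3 r4 s lamC tC szC * S)) ∧
    (∀ (P : Matrix (Mi t1 t2 t3 t4 r1 r2 r3 r4 s tC szC) (Ni t1 t2 t3 t4 r1 r2 r3 r4 s tC szC) ℝ)
       (Q : Matrix (Ni t1 t2 t3 t4 r1 r2 r3 r4 s tC szC) (Mi t1 t2 t3 t4 r1 r2 r3 r4 s tC szC) ℝ)
       (S : Matrix (Mi t1 t2 t3 t4 r1 r2 r3 r4 s tC szC) (Mi t1 t2 t3 t4 r1 r2 r3 r4 s tC szC) ℝ)
       (R : Matrix (Ni t1 t2 t3 t4 r1 r2 r3 r4 s tC szC) (Ni t1 t2 t3 t4 r1 r2 r3 r4 s tC szC) ℝ),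
        (∀ x y, ¬ PSupp t1 t2 t3 t4 r1 r2 r3 r4 s tC szC x y → P x y = 0) →
        (∀ x y, ¬ QSupp t1 t2 t3 t4 r1 r2 r3 r4 s tC szC x y → Q x y = 0) →
        P + (S * A t1 t2 t3 t4 r1 r2 r3 r4 s tC szC
              - A t1 t2 t3 t4 r1 r2 r3 r4 s tC szC * R) = 0 →
        Q + (R * B t1 t2 t3 t4 r1 r2 r3 r4 s lamC tC szC
              - B t1 t2 t3 t4 r1 r2 r3 r4 s lamC tC szC * S) = 0 →
        P = 0 ∧ Q = 0 ∧
          S * A t1 t2 t3 t4 r1 r2 r3 r4 s tC szC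
            - A t1 t2 t3 t4 r1 r2 r3 r4 s tC szC * R = 0 ∧
          R * B t1 t2 t3 t4 r1 r2 r3 r4 s lamC tC szC
            - B t1 t2 t3 t4 r1 r2 r3 r4 s lamC tC szC * S = 0) := by
  have hA : A t1 t2 t3 t4 r1 r2 r3 r4 s tC szC =
      fromBlocks (1 : Matrix (CI s tC szC) (CI s tC szC) ℝ) 0 0
        (A t1 t2 t3 t4 r1 r2 r3 r4 s tC szC).toBlocks₂₂ := by
    ext (x | u) (y | v)
    · simp [A, one_apply]
    · rcases v with ⟨j, b⟩ | ⟨j, b⟩ | ⟨j, b⟩ | ⟨j, b⟩ <;> rfl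
    · rcases u with ⟨j, b⟩ | ⟨j, b⟩ | ⟨j, b⟩ | ⟨j, b⟩ <;> rfl
    · rfl
  have hB : B t1 t2 t3 t4 r1 r2 r3 r4 s lamC tC szC =
      fromBlocks (B t1 t2 t3 t4 r1 r2 r3 r4 s lamC tC szC).toBlocks₁₁ 0 0
        (B t1 t2 t3 t4 r1 r2 r3 r4 s lamC tC szC).toBlocks₂₂ := by
    ext (x | u) (y | v)
    · rfl
    · rcases v with ⟨j, b⟩ | ⟨j, b⟩ | ⟨j, b⟩ | ⟨j, b⟩ <;> rfl
    · rcases u with ⟨j, b⟩ | ⟨j, b⟩ | ⟨j, b⟩ | ⟨j, b⟩ <;> rfl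
    · rfl
  obtain ⟨hex, huniq⟩ := contragredient_decomposition
    (p := PSupp t1 t2 t3 t4 r1 r2 r3 r4 s tC szC) (q := QSupp t1 t2 t3 t4 r1 r2 r3 r4 s tC szC)
    (supportCompl_B_toBlocks₁₁ t1 t2 t3 t4 r1 r2 r3 r4 s lamC tC szC hlam him heven)
    (isUnit_B_toBlocks₁₁ t1 t2 t3 t4 r1 r2 r3 r4 s lamC tC szC hlam0 him heven)
    (supportCompl_fromBlocks_toBlocks₂₂ t1 t2 t3 t4 r1 r2 r3 r4 s lamC tC szC hr3 hr3m hr4 hr4m)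
    (isNilpotent_fromBlocks_toBlocks₂₂ t1 t2 t3 t4 r1 r2 r3 r4 s lamC tC szC)
    (fun x v h => h) (fun u x h => by rcases u with ⟨j, b⟩ | ⟨j, b⟩ | ⟨j, b⟩ | ⟨j, b⟩ <;> exact h)
    (fun u v => (nilSupp_nilEquiv_inl_inr t1 t2 t3 t4 r1 r2 r3 r4 s tC szC u v).symm)
    (fun x y => Iff.rfl)
    (fun x u h => by rcases u with ⟨j, b⟩ | ⟨j, b⟩ | ⟨j, b⟩ | ⟨j, b⟩ <;> exact h)
    (fun v x h => by rcases v with ⟨j, b⟩ | ⟨j, b⟩ | ⟨j, b⟩ | ⟨j, b⟩ <;> exact h)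
    (fun u v => (nilSupp_nilEquiv_inr_inl t1 t2 t3 t4 r1 r2 r3 r4 s tC szC u v).symm)
  rw [← hA, ← hB] at hex huniq
  refine ⟨hex, fun P Q S R hP hQ h1 h2 => ?_⟩
  obtain ⟨rfl, rfl⟩ := huniq P Q S R hP hQ h1 h2
  exact ⟨rfl, rfl, by rwa [zero_add] at h1, by rwa [zero_add] at h2⟩

end ContragredientReal
end

section
/- Let F be ℝ or ℂ and let p ≥ q ≥ 1. For every M ∈ F^{p×(q−1)} and N ∈ F^{(p−1)×q} there exist S ∈ F^{p×q}, R ∈ F^{(p−1)×(q−1)}, and a matrix H ∈ F^{p×(q−1)} that is zero outside its last row, such that M + S F_q − F_p R = H and N + R G_q − G_p S = 0; moreover H is uniquely determined by (M,N). -/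
open Matrix

/-- The `r × (r−1)` matrix `F_r` with `1` in positions `(i, i)` and `0` elsewhere. -/
def Fmat (F : Type*) [Zero F] [One F] (r : ℕ) : Matrix (Fin r) (Fin (r - 1)) F :=
  Matrix.of fun i j => if (i : ℕ) = (j : ℕ) then 1 else 0

/-- The `r × (r−1)` matrix `K_r` with `1` in positions `(i+1, i)` and `0` elsewhere. -/
def Kmat (F : Type*) [Zero F] [One F] (r : ℕ) : Matrix (Fin r) (Fin (r - 1)) F :=
  Matrix.of fun i j => if (i : ℕ) = (j : ℕ) + 1 then 1 else 0

/-- `G_r := K_r^T`, of size `(r−1) × r`. -/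
def Gmat (F : Type*) [Zero F] [One F] (r : ℕ) : Matrix (Fin (r - 1)) (Fin r) F :=
  (Kmat F r)ᵀ

/-- `H` is zero outside its last row. -/
def IsLastRow {F : Type*} [Zero F] {p q : ℕ} (H : Matrix (Fin p) (Fin q) F) : Prop :=
  ∀ (i : Fin p) (j : Fin q), (i : ℕ) ≠ p - 1 → H i j = 0

section EntryFormulas

variable {F : Type*} [Semiring F] {m : Type*}

theorem mul_Fmat_apply {r : ℕ} (A : Matrix m (Fin r) F) (i : m) (j : Fin (r - 1)) :
    (A * Fmat F r) i j = A i ⟨j, by omega⟩ := by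
  rw [Matrix.mul_apply, Finset.sum_eq_single ⟨j, by omega⟩] <;>
    simp +contextual [Fmat, Fin.ext_iff]

theorem Fmat_mul_apply_of_lt {r : ℕ} (A : Matrix (Fin (r - 1)) m F) (i : Fin r) (j : m)
    (h : (i : ℕ) < r - 1) : (Fmat F r * A) i j = A ⟨i, h⟩ j := by
  rw [Matrix.mul_apply, Finset.sum_eq_single ⟨i, h⟩] <;>
    simp +contextual [Fmat, Fin.ext_iff, eq_comm]

theorem Fmat_mul_apply_last {r : ℕ} (A : Matrix (Fin (r - 1)) m F) (i : Fin r) (j : m)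
    (h : (i : ℕ) = r - 1) : (Fmat F r * A) i j = 0 := by
  rw [Matrix.mul_apply]
  refine Finset.sum_eq_zero fun k _ => ?_
  have : (i : ℕ) ≠ k := by omega
  simp [Fmat, this]

theorem mul_Gmat_apply_zero {r : ℕ} (A : Matrix m (Fin (r - 1)) F) (i : m) (h : 0 < r) :
    (A * Gmat F r) i ⟨0, h⟩ = 0 := by
  simp [Matrix.mul_apply, Gmat, Kmat]

theorem mul_Gmat_apply_succ {r : ℕ} (A : Matrix m (Fin (r - 1)) F) (i : m) (j : ℕ)
    (h : j + 1 < r) : (A * Gmat F r) i ⟨j + 1, h⟩ = A i ⟨j, by omega⟩ := by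
  rw [Matrix.mul_apply, Finset.sum_eq_single ⟨j, by omega⟩] <;>
    simp +contextual [Gmat, Kmat, Fin.ext_iff, eq_comm]

theorem Gmat_mul_apply {r : ℕ} (A : Matrix (Fin r) m F) (i : Fin (r - 1)) (j : m) :
    (Gmat F r * A) i j = A ⟨i + 1, by omega⟩ j := by
  rw [Matrix.mul_apply, Finset.sum_eq_single ⟨i + 1, by omega⟩] <;>
    simp +contextual [Gmat, Kmat, Fin.ext_iff]

end EntryFormulas

/-- The solution of `s (i + 1) (j + 1) = n i (j + 1) + m i j + s i j`, `s (i + 1) 0 = n i 0`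
with zero initial row. -/
def diagonalSolution {F : Type*} [Semiring F] (m n : ℕ → ℕ → F) : ℕ → ℕ → F
  | 0, _ => 0
  | i + 1, 0 => n i 0
  | i + 1, j + 1 => n i (j + 1) + m i j + diagonalSolution m n i j

/-- The entries strictly below the diagonal of the first matrix of a solution pair are
determined by the right-hand sides. -/
theorem eq_of_lt_of_isLastRow {F : Type*} [Ring F] {p q : ℕ}
    {M : Matrix (Fin p) (Fin (q - 1)) F} {N : Matrix (Fin (p - 1)) (Fin q) F}
    {S S' : Matrix (Fin p) (Fin q) F} {R R' : Matrix (Fin (p - 1)) (Fin (q - 1)) F}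
    (hH : IsLastRow (M + S * Fmat F q - Fmat F p * R))
    (hH' : IsLastRow (M + S' * Fmat F q - Fmat F p * R'))
    (hN : N + R * Gmat F q - Gmat F p * S = 0)
    (hN' : N + R' * Gmat F q - Gmat F p * S' = 0)
    (i j : ℕ) (hi : i < p) (hj : j < q) (hji : j < i) :
    S ⟨i, hi⟩ ⟨j, hj⟩ = S' ⟨i, hi⟩ ⟨j, hj⟩ := by
  induction i generalizing j with
  | zero => omega
  | succ i ih =>
    have e := congrFun₂ hN ⟨i, by omega⟩ ⟨j, hj⟩
    have e' := congrFun₂ hN' ⟨i, by omega⟩ ⟨j, hj⟩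
    simp only [Matrix.sub_apply, Matrix.add_apply, Matrix.zero_apply, Gmat_mul_apply,
      sub_eq_zero] at e e'
    rw [← e, ← e']
    cases j with
    | zero => simp only [mul_Gmat_apply_zero]
    | succ j =>
      have f := hH ⟨i, by omega⟩ ⟨j, by omega⟩ (by simp only; omega)
      have f' := hH' ⟨i, by omega⟩ ⟨j, by omega⟩ (by simp only; omega)
      have hlt : i < p - 1 := by omega
      rw [Matrix.sub_apply, Matrix.add_apply, mul_Fmat_apply, Fmat_mul_apply_of_lt _ _ _ hlt,
        sub_eq_zero] at f f'
      rw [mul_Gmat_apply_succ, mul_Gmat_apply_succ, ← f, ← f',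
        ih j (by omega) (by omega) (by omega)]

/-- Case 8 of the paper's Theorem 4.1: interaction of the contragredient summands
`(F_p, G_p)` and `(F_q, G_q)` with `p ≥ q`. -/
theorem contragredient_case8 (F : Type*) [RCLike F] (p q : ℕ) (hq : 1 ≤ q) (hpq : q ≤ p)
    (M : Matrix (Fin p) (Fin (q - 1)) F) (N : Matrix (Fin (p - 1)) (Fin q) F) :
    (∃ (S : Matrix (Fin p) (Fin q) F) (R : Matrix (Fin (p - 1)) (Fin (q - 1)) F)
        (H : Matrix (Fin p) (Fin (q - 1)) F), IsLastRow H ∧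
        M + S * Fmat F q - Fmat F p * R = H ∧
        N + R * Gmat F q - Gmat F p * S = 0) ∧
    (∀ (S S' : Matrix (Fin p) (Fin q) F) (R R' : Matrix (Fin (p - 1)) (Fin (q - 1)) F)
        (H H' : Matrix (Fin p) (Fin (q - 1)) F), IsLastRow H → IsLastRow H' →
        M + S * Fmat F q - Fmat F p * R = H →
        N + R * Gmat F q - Gmat F p * S = 0 →
        M + S' * Fmat F q - Fmat F p * R' = H' →
        N + R' * Gmat F q - Gmat F p * S' = 0 → H = H') := by
  constructor
  · let m : ℕ → ℕ → F := fun i j =>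
      if h : i < p ∧ j < q - 1 then M ⟨i, h.1⟩ ⟨j, h.2⟩ else 0
    let n : ℕ → ℕ → F := fun i j =>
      if h : i < p - 1 ∧ j < q then N ⟨i, h.1⟩ ⟨j, h.2⟩ else 0
    have hm (i : ℕ) (j : ℕ) (hi : i < p) (hj : j < q - 1) : m i j = M ⟨i, hi⟩ ⟨j, hj⟩ :=
      dif_pos ⟨hi, hj⟩
    have hn (i : ℕ) (j : ℕ) (hi : i < p - 1) (hj : j < q) : n i j = N ⟨i, hi⟩ ⟨j, hj⟩ :=
      dif_pos ⟨hi, hj⟩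
    let S : Matrix (Fin p) (Fin q) F := of fun i j => diagonalSolution m n i j
    let R : Matrix (Fin (p - 1)) (Fin (q - 1)) F :=
      of fun i j => m i j + diagonalSolution m n i j
    refine ⟨S, R, _, fun i j hi => ?_, rfl, ?_⟩
    · have hlt : (i : ℕ) < p - 1 := by omega
      rw [Matrix.sub_apply, Matrix.add_apply, mul_Fmat_apply, Fmat_mul_apply_of_lt _ _ _ hlt]
      simp only [S, R, of_apply, hm _ _ i.2 j.2, sub_self]
    · ext i ⟨j, hj⟩
      rw [Matrix.sub_apply, Matrix.add_apply, Gmat_mul_apply, Matrix.zero_apply]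
      cases j with
      | zero =>
        rw [mul_Gmat_apply_zero]
        simp only [S, of_apply, diagonalSolution, hn _ _ i.2 hj, add_zero, sub_self]
      | succ j =>
        rw [mul_Gmat_apply_succ]
        simp only [S, R, of_apply, diagonalSolution, hn _ _ i.2 hj]
        ring
  · rintro S S' R R' _ _ hH hH' rfl hN rfl hN'
    ext i j
    by_cases hi : (i : ℕ) = p - 1
    · simp only [Matrix.sub_apply, Matrix.add_apply, mul_Fmat_apply,
        Fmat_mul_apply_last _ _ _ hi]
      rw [eq_of_lt_of_isLastRow hH hH' hN hN' i j i.2 (by omega) (by omega)]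
    · rw [hH i j hi, hH' i j hi]
end

section
/- Let F be ℝ or ℂ and let p, q ≥ 1. For every M ∈ F^{p×q} and N ∈ F^{(p−1)×(q−1)} there exist S ∈ F^{p×(q−1)}, R ∈ F^{(p−1)×q}, and a matrix H ∈ F^{p×q} of form (5.1) (i.e., zero outside its first column if p ≤ q, and zero outside its last row if p > q), such that M + S G_q − F_p R = H and N + R F_q − G_p S = 0; moreover H is uniquely determined by (M,N). -/
open Matrix

/-- A `p × q` matrix `H` is of form (5.1) if: in case `p ≤ q` all entries outside its
first column are zero, and in case `p > q` all entries outside its last row are zero. -/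
def IsForm51 {F : Type*} [Zero F] {p q : ℕ} (H : Matrix (Fin p) (Fin q) F) : Prop :=
  if p ≤ q then ∀ (i : Fin p) (j : Fin q), (j : ℕ) ≠ 0 → H i j = 0
  else ∀ (i : Fin p) (j : Fin q), (i : ℕ) ≠ p - 1 → H i j = 0

/-- The matrix `F_{r+1}`, with its size written as `(r + 1) × r`. -/
def Fsucc (F : Type*) [Zero F] [One F] (r : ℕ) : Matrix (Fin (r + 1)) (Fin r) F :=
  Fmat F (r + 1)

/-- The matrix `G_{r+1}`, with its size written as `r × (r + 1)`. -/
def Gsucc (F : Type*) [Zero F] [One F] (r : ℕ) : Matrix (Fin r) (Fin (r + 1)) F :=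
  Gmat F (r + 1)

section EntryFormulas

variable {F : Type*} [Ring F] {m n : ℕ} {ι : Type*}

lemma mul_Gsucc_zero (S : Matrix ι (Fin n) F) (i : ι) :
    (S * Gsucc F n) i 0 = 0 := by
  simp [Matrix.mul_apply, Gsucc, Gmat, Kmat]

lemma mul_Gsucc_succ (S : Matrix ι (Fin n) F) (i : ι) (j : Fin n) :
    (S * Gsucc F n) i j.succ = S i j := by
  simp [Matrix.mul_apply, Gsucc, Gmat, Kmat, ← Fin.ext_iff]

lemma mul_Fsucc_apply (R : Matrix ι (Fin (n + 1)) F) (i : ι) (j : Fin n) :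
    (R * Fsucc F n) i j = R i j.castSucc := by
  have h (x : Fin (n + 1)) : (x : ℕ) = (j : ℕ) ↔ x = j.castSucc := by simp [Fin.ext_iff]
  simp [Matrix.mul_apply, Fsucc, Fmat, h]

lemma Gsucc_mul_apply (S : Matrix (Fin (m + 1)) ι F) (i : Fin m) (j : ι) :
    (Gsucc F m * S) i j = S i.succ j := by
  have h (x : Fin (m + 1)) : (x : ℕ) = (i : ℕ) + 1 ↔ x = i.succ := by simp [Fin.ext_iff]
  simp [Matrix.mul_apply, Gsucc, Gmat, Kmat, h]

lemma Fsucc_mul_castSucc (R : Matrix (Fin m) ι F) (i : Fin m) (j : ι) :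
    (Fsucc F m * R) i.castSucc j = R i j := by
  simp [Matrix.mul_apply, Fsucc, Fmat, ← Fin.ext_iff]

lemma Fsucc_mul_last (R : Matrix (Fin m) ι F) (j : ι) :
    (Fsucc F m * R) (Fin.last m) j = 0 := by
  simp [Matrix.mul_apply, Fsucc, Fmat, (Fin.is_lt _).ne']

end EntryFormulas

section DiagonalRecursion

variable {F : Type*} [AddCommGroup F]

/-- The recursion `d (i + 1) (j + 1) = d i j + a i j` along diagonals is solvable with zero values
on the axes. -/
lemma exists_diagonal_of_axes (a : ℕ → ℕ → F) :
    ∃ d : ℕ → ℕ → F, (∀ i, d i 0 = 0) ∧ ∀ i j, d (i + 1) (j + 1) = d i j + a i j := by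
  refine ⟨fun i j => ∑ t ∈ Finset.range (min i j), a (i - 1 - t) (j - 1 - t), by simp, ?_⟩
  intro i j
  simp only [Nat.add_min_add_right, Finset.sum_range_succ', Nat.add_sub_cancel, Nat.sub_zero]
  simp only [Nat.sub_sub, Nat.add_comm 1]

/-- The recursion `d (i + 1) (j + 1) = d i j + a i j` along diagonals is solvable up to row `k`
with zero values in row `k`. -/
lemma exists_diagonal_of_row (a : ℕ → ℕ → F) (k : ℕ) :
    ∃ d : ℕ → ℕ → F, (∀ j, d k j = 0) ∧ ∀ i < k, ∀ j, d (i + 1) (j + 1) = d i j + a i j := by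
  refine ⟨fun i j => -∑ t ∈ Finset.range (k - i), a (i + t) (j + t), by simp, ?_⟩
  intro i hi j
  obtain ⟨l, rfl⟩ := Nat.exists_eq_add_of_lt hi
  have h₁ : i + l + 1 - i = l + 1 := by omega
  have h₂ : i + l + 1 - (i + 1) = l := by omega
  simp only [h₁, h₂, Finset.sum_range_succ', Nat.add_zero]
  simp only [Nat.add_assoc, Nat.add_comm 1]
  abel

end DiagonalRecursion

section Reduction

variable {F : Type*} [Ring F] {p q : ℕ}

lemma exists_Gsucc_mul_eq (N : Matrix (Fin p) (Fin q) F) :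
    ∃ S : Matrix (Fin (p + 1)) (Fin q) F, Gsucc F p * S = N := by
  refine ⟨Matrix.of fun i j => Fin.cases 0 (fun k => N k j) i, ?_⟩
  ext i j
  simp [Gsucc_mul_apply]

/-- Every `A` can be reduced to a matrix supported in its first column. -/
lemma exists_reduction_firstColumn (A : Matrix (Fin (p + 1)) (Fin (q + 1)) F) :
    ∃ (S : Matrix (Fin (p + 1)) (Fin q) F) (R : Matrix (Fin p) (Fin (q + 1)) F),
      R * Fsucc F q = Gsucc F p * S ∧
      ∀ i (j : Fin q), (A + S * Gsucc F q - Fsucc F p * R) i j.succ = 0 := by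
  obtain ⟨d, hd₀, hd⟩ := exists_diagonal_of_row
    (fun i j => if h : i < p + 1 ∧ j < q + 1 then A ⟨i, h.1⟩ ⟨j, h.2⟩ else 0) (p + 1)
  refine ⟨Matrix.of fun i j => d i (j + 1), Matrix.of fun i j => d (i + 1) (j + 1), ?_, ?_⟩
  · ext i j
    rw [mul_Fsucc_apply, Gsucc_mul_apply]
    simp
  · intro i j
    have h := hd i i.is_lt (j + 1)
    rw [Matrix.sub_apply, Matrix.add_apply, mul_Gsucc_succ]
    induction i using Fin.lastCases with
    | last =>
      rw [Fsucc_mul_last]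
      rw [dif_pos ⟨by simp, by omega⟩] at h
      exact (sub_zero _).trans ((add_comm _ _).trans (h.symm.trans (hd₀ _)))
    | cast i =>
      rw [Fsucc_mul_castSucc]
      have hi : (i : ℕ) < p + 1 := by omega
      rw [dif_pos ⟨hi, by omega⟩] at h
      exact sub_eq_zero.2 ((add_comm _ _).trans h.symm)

/-- Every `A` can be reduced to a matrix supported in its last row. -/
lemma exists_reduction_lastRow (A : Matrix (Fin (p + 1)) (Fin (q + 1)) F) :
    ∃ (S : Matrix (Fin (p + 1)) (Fin q) F) (R : Matrix (Fin p) (Fin (q + 1)) F),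
      R * Fsucc F q = Gsucc F p * S ∧
      ∀ (i : Fin p) j, (A + S * Gsucc F q - Fsucc F p * R) i.castSucc j = 0 := by
  obtain ⟨d, hd₀, hd⟩ := exists_diagonal_of_axes
    (fun i j => if h : i < p + 1 ∧ j < q + 1 then A ⟨i, h.1⟩ ⟨j, h.2⟩ else 0)
  refine ⟨Matrix.of fun i j => d i (j + 1), Matrix.of fun i j => d (i + 1) (j + 1), ?_, ?_⟩
  · ext i j
    rw [mul_Fsucc_apply, Gsucc_mul_apply]
    simp
  · intro i j
    have h := hd i j
    have hi : (i : ℕ) < p + 1 := by omega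
    rw [Matrix.sub_apply, Matrix.add_apply, Fsucc_mul_castSucc]
    induction j using Fin.cases with
    | zero =>
      rw [mul_Gsucc_zero]
      rw [dif_pos ⟨hi, by simp⟩] at h
      have h₀ : d i (0 : Fin (q + 1)) = 0 := hd₀ i
      rw [h₀, zero_add] at h
      exact sub_eq_zero.2 ((add_zero _).trans h.symm)
    | succ j =>
      rw [mul_Gsucc_succ]
      rw [dif_pos ⟨hi, by omega⟩] at h
      exact sub_eq_zero.2 ((add_comm _ _).trans h.symm)

end Reduction

section Uniqueness

variable {F : Type*} [Ring F] {p q : ℕ} {S : Matrix (Fin (p + 1)) (Fin q) F}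
  {R : Matrix (Fin p) (Fin (q + 1)) F}

lemma eq_zero_of_firstColumn (hpq : p ≤ q)
    (hRS : R * Fsucc F q = Gsucc F p * S)
    (hH : ∀ i (j : Fin q), (S * Gsucc F q - Fsucc F p * R) i j.succ = 0) :
    S * Gsucc F q - Fsucc F p * R = 0 := by
  have hR (i : Fin p) (j : Fin q) : R i j.castSucc = S i.succ j := by
    rw [← mul_Fsucc_apply R, hRS, Gsucc_mul_apply]
  have hS (i : Fin (p + 1)) : ∀ j : Fin q, p + j < q + i → S i j = 0 := by
    induction i using Fin.reverseInduction with
    | last =>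
      intro j _
      have h := hH (Fin.last p) j
      rwa [Matrix.sub_apply, mul_Gsucc_succ, Fsucc_mul_last, sub_zero] at h
    | cast i ih =>
      intro j hj
      rw [Fin.val_castSucc] at hj
      have h := hH i.castSucc j
      have hj' : (j : ℕ) + 1 < q := by omega
      have hcast : j.succ = Fin.castSucc ⟨j + 1, hj'⟩ := rfl
      rw [Matrix.sub_apply, mul_Gsucc_succ, Fsucc_mul_castSucc, sub_eq_zero, hcast, hR] at h
      rw [h]
      exact ih _ (by simp; omega)
  ext i j
  induction j using Fin.cases with
  | succ j => exact hH i j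
  | zero =>
    rw [Matrix.sub_apply, mul_Gsucc_zero, Matrix.zero_apply, zero_sub, neg_eq_zero]
    induction i using Fin.lastCases with
    | last => exact Fsucc_mul_last R 0
    | cast i =>
      have hcast : (0 : Fin (q + 1)) = Fin.castSucc ⟨0, i.pos.trans_le hpq⟩ := rfl
      rw [Fsucc_mul_castSucc, hcast, hR]
      exact hS _ _ (by simp; omega)

lemma eq_zero_of_lastRow (hpq : q < p)
    (hRS : R * Fsucc F q = Gsucc F p * S)
    (hH : ∀ (i : Fin p) j, (S * Gsucc F q - Fsucc F p * R) i.castSucc j = 0) :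
    S * Gsucc F q - Fsucc F p * R = 0 := by
  have hR (i : Fin p) (j : Fin q) : R i j.castSucc = S i.succ j := by
    rw [← mul_Fsucc_apply R, hRS, Gsucc_mul_apply]
  have hS (i : Fin (p + 1)) : ∀ j : Fin q, (j : ℕ) < i → S i j = 0 := by
    induction i using Fin.induction with
    | zero => simp
    | succ i ih =>
      intro j hj
      have h := hH i j.castSucc
      rw [Matrix.sub_apply, Fsucc_mul_castSucc, hR, sub_eq_zero] at h
      rw [← h]
      obtain ⟨j, hjq⟩ := j
      cases j with
      | zero => exact mul_Gsucc_zero S _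
      | succ j =>
        have hcast : Fin.castSucc ⟨j + 1, hjq⟩ = Fin.succ (⟨j, by omega⟩ : Fin q) := rfl
        rw [hcast, mul_Gsucc_succ]
        exact ih _ (by simpa using hj)
  ext i j
  induction i using Fin.lastCases with
  | cast i => exact hH i j
  | last =>
    rw [Matrix.sub_apply, Fsucc_mul_last, Matrix.zero_apply, sub_zero]
    induction j using Fin.cases with
    | zero => exact mul_Gsucc_zero S _
    | succ j =>
      rw [mul_Gsucc_succ]
      exact hS _ _ (by simp; omega)

end Uniqueness

lemma isForm51_iff_of_le {F : Type*} [Zero F] {p q : ℕ} (hpq : p ≤ q)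
    (H : Matrix (Fin (p + 1)) (Fin (q + 1)) F) :
    IsForm51 H ↔ ∀ i (j : Fin q), H i j.succ = 0 := by
  simp [IsForm51, hpq, Fin.forall_fin_succ (n := q)]

lemma isForm51_iff_of_lt {F : Type*} [Zero F] {p q : ℕ} (hpq : q < p)
    (H : Matrix (Fin (p + 1)) (Fin (q + 1)) F) :
    IsForm51 H ↔ ∀ (i : Fin p) j, H i.castSucc j = 0 := by
  simp [IsForm51, hpq, Fin.forall_fin_succ' (n := p), (Fin.is_lt _).ne]

/-- The homogeneous case: the only matrix satisfying `IsForm51` that is equivalent to zero is zero. -/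
lemma IsForm51.eq_zero {F : Type*} [Ring F] {p q : ℕ} {S : Matrix (Fin (p + 1)) (Fin q) F}
    {R : Matrix (Fin p) (Fin (q + 1)) F}
    (hH : IsForm51 (S * Gsucc F q - Fsucc F p * R))
    (hRS : R * Fsucc F q = Gsucc F p * S) :
    S * Gsucc F q - Fsucc F p * R = 0 := by
  rcases le_or_gt p q with hpq | hpq
  · exact eq_zero_of_firstColumn hpq hRS ((isForm51_iff_of_le hpq _).1 hH)
  · exact eq_zero_of_lastRow hpq hRS ((isForm51_iff_of_lt hpq _).1 hH)

lemma exists_isForm51 {F : Type*} [Ring F] {p q : ℕ}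
    (A : Matrix (Fin (p + 1)) (Fin (q + 1)) F) :
    ∃ (S : Matrix (Fin (p + 1)) (Fin q) F) (R : Matrix (Fin p) (Fin (q + 1)) F),
      R * Fsucc F q = Gsucc F p * S ∧
      IsForm51 (A + S * Gsucc F q - Fsucc F p * R) := by
  rcases le_or_gt p q with hpq | hpq
  · simpa only [isForm51_iff_of_le hpq] using exists_reduction_firstColumn A
  · simpa only [isForm51_iff_of_lt hpq] using exists_reduction_lastRow A

lemma IsForm51.sub {F : Type*} [AddGroup F] {p q : ℕ} {H H' : Matrix (Fin p) (Fin q) F}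
    (hH : IsForm51 H) (hH' : IsForm51 H') : IsForm51 (H - H') := by
  unfold IsForm51 at *
  split_ifs at * <;> intro i j hij <;> simp [hH i j hij, hH' i j hij]

lemma exists_isForm51_reduction {F : Type*} [Ring F] {p q : ℕ}
    (M : Matrix (Fin (p + 1)) (Fin (q + 1)) F) (N : Matrix (Fin p) (Fin q) F) :
    ∃ (S : Matrix (Fin (p + 1)) (Fin q) F) (R : Matrix (Fin p) (Fin (q + 1)) F)
      (H : Matrix (Fin (p + 1)) (Fin (q + 1)) F), IsForm51 H ∧
      M + S * Gsucc F q - Fsucc F p * R = H ∧ N + R * Fsucc F q - Gsucc F p * S = 0 := by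
  obtain ⟨S₀, hS₀⟩ := exists_Gsucc_mul_eq N
  obtain ⟨S, R, hRS, hH⟩ := exists_isForm51 (M + S₀ * Gsucc F q)
  refine ⟨S₀ + S, R, _, hH, ?_, ?_⟩
  · rw [Matrix.add_mul, ← add_assoc]
  · rw [Matrix.mul_add, hS₀, hRS, sub_self]

lemma isForm51_reduction_unique {F : Type*} [Ring F] {p q : ℕ}
    {M H H' : Matrix (Fin (p + 1)) (Fin (q + 1)) F} {N : Matrix (Fin p) (Fin q) F}
    {S S' : Matrix (Fin (p + 1)) (Fin q) F} {R R' : Matrix (Fin p) (Fin (q + 1)) F}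
    (hH : IsForm51 H) (hH' : IsForm51 H')
    (hM : M + S * Gsucc F q - Fsucc F p * R = H)
    (hN : N + R * Fsucc F q - Gsucc F p * S = 0)
    (hM' : M + S' * Gsucc F q - Fsucc F p * R' = H')
    (hN' : N + R' * Fsucc F q - Gsucc F p * S' = 0) : H = H' := by
  have hsub : H - H' = (S - S') * Gsucc F q - Fsucc F p * (R - R') := by
    rw [← hM, ← hM', Matrix.sub_mul, Matrix.mul_sub]
    abel
  have hRS : (R - R') * Fsucc F q = Gsucc F p * (S - S') := by
    rw [Matrix.sub_mul, Matrix.mul_sub, ← sub_eq_zero, ← sub_eq_zero.2 (hN.trans hN'.symm)]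
    abel
  have hform := hH.sub hH'
  rw [hsub] at hform
  rw [← sub_eq_zero, hsub]
  exact hform.eq_zero hRS

/-- Case 9 of the paper's Theorem 4.1: interaction of the contragredient summands
`(F_p, G_p)` and `(G_q, F_q)`. -/
theorem contragredient_case9 (F : Type*) [RCLike F] (p q : ℕ) (hp : 1 ≤ p) (hq : 1 ≤ q)
    (M : Matrix (Fin p) (Fin q) F) (N : Matrix (Fin (p - 1)) (Fin (q - 1)) F) :
    (∃ (S : Matrix (Fin p) (Fin (q - 1)) F) (R : Matrix (Fin (p - 1)) (Fin q) F)
        (H : Matrix (Fin p) (Fin q) F), IsForm51 H ∧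
        M + S * Gmat F q - Fmat F p * R = H ∧
        N + R * Fmat F q - Gmat F p * S = 0) ∧
    (∀ (S S' : Matrix (Fin p) (Fin (q - 1)) F) (R R' : Matrix (Fin (p - 1)) (Fin q) F)
        (H H' : Matrix (Fin p) (Fin q) F), IsForm51 H → IsForm51 H' →
        M + S * Gmat F q - Fmat F p * R = H →
        N + R * Fmat F q - Gmat F p * S = 0 →
        M + S' * Gmat F q - Fmat F p * R' = H' →
        N + R' * Fmat F q - Gmat F p * S' = 0 → H = H') := by
  obtain ⟨p, rfl⟩ := Nat.exists_eq_add_of_le' hp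
  obtain ⟨q, rfl⟩ := Nat.exists_eq_add_of_le' hq
  exact ⟨exists_isForm51_reduction M N, fun _ _ _ _ _ _ hH hH' hM hN hM' hN' =>
    isForm51_reduction_unique hH hH' hM hN hM' hN'⟩
end
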